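/- arXiv:1111.1376 — 7 statements merged into one kernel-verified Lean document; each statement's English description precedes it below -/
import Mathlib

section
/- For every finite set S with n ≥ 2 elements, the maximum size of a minimal separating family of bipartitions for S is n − 1; that is, every minimal separating family for S has at most n − 1 bipartitions, and there exists a minimal separating family for S of size exactly n − 1. -/
open Finset

variable {α : Type*} [DecidableEq α]

/-- A *bipartition* of a finite set `S`: a collection of at most two pairwise disjoint
nonempty subsets of `S` whose union is `S`. -/
def IsBipartition (S : Finset α) (P : Finset (Finset α)) : Prop :=
  P.card ≤ 2 ∧ (∀ A ∈ P, A.Nonempty) ∧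
    (∀ A ∈ P, ∀ B ∈ P, A ≠ B → Disjoint A B) ∧ P.sup id = S

/-- The bipartition `P` *cuts* the elements `x` and `y`:
they lie in different components of `P`. -/
def Cuts (P : Finset (Finset α)) (x y : α) : Prop :=
  ∃ A ∈ P, ∃ B ∈ P, A ≠ B ∧ x ∈ A ∧ y ∈ B

/-- A family `F` of bipartitions is *separating* for `S` if every two distinct
elements of `S` are cut by some member of `F`. -/
def IsSeparating (S : Finset α) (F : Finset (Finset (Finset α))) : Prop :=
  ∀ x ∈ S, ∀ y ∈ S, x ≠ y → ∃ P ∈ F, Cuts P x y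

/-- A separating family is *minimal* if no proper subfamily is separating. -/
def IsMinimalSeparating (S : Finset α) (F : Finset (Finset (Finset α))) : Prop :=
  IsSeparating S F ∧ ∀ F2 ⊂ F, ¬ IsSeparating S F2

/-- The members of `F` together with the constant function give linearly independent
functions on `S` as soon as each member cuts a pair that no other member cuts. -/
theorem card_lt_of_private_cuts {S : Finset α} (hS : S.Nonempty)
    {F : Finset (Finset (Finset α))} (hF : ∀ P ∈ F, IsBipartition S P)
    (h : ∀ P ∈ F, ∃ x ∈ S, ∃ y ∈ S, Cuts P x y ∧ ∀ Q ∈ F, Q ≠ P → ¬ Cuts Q x y) :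
    F.card < S.card := by
  have : Nonempty α := ⟨hS.choose⟩
  choose! x hx y hy hcut hpriv using h
  choose! A hA B hB hAB hxA hyB using hcut
  have hyA : ∀ P ∈ F, y P ∉ A P := fun P hP hy' =>
    Finset.disjoint_left.1 ((hF P hP).2.2.1 _ (hA P hP) _ (hB P hP) (hAB P hP)) hy' (hyB P hP)
  have cover : ∀ P ∈ F, ∀ z ∈ S, ∃ C ∈ P, z ∈ C := fun P hP z hz => by
    rw [← (hF P hP).2.2.2] at hz
    simpa [Finset.mem_sup] using hz
  have same : ∀ P ∈ F, ∀ Q ∈ F, Q ≠ P → (x P ∈ A Q ↔ y P ∈ A Q) := by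
    intro P hP Q hQ hne
    have hn := hpriv P hP Q hQ hne
    constructor
    · intro h1
      by_contra h2
      obtain ⟨C, hC, hyC⟩ := cover Q hQ _ (hy P hP)
      exact hn ⟨A Q, hA Q hQ, C, hC, fun e => h2 (e ▸ hyC), h1, hyC⟩
    · intro h1
      by_contra h2
      obtain ⟨C, hC, hxC⟩ := cover Q hQ _ (hx P hP)
      exact hn ⟨C, hC, A Q, hA Q hQ, fun e => h2 (e ▸ hxC), hxC, h1⟩
  let v : Option F → S → ℚ := fun o s => o.elim 1 fun P => if (s : α) ∈ A P then 1 else 0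
  have hv : LinearIndependent ℚ v := by
    rw [Fintype.linearIndependent_iff]
    intro g hg
    have ev : ∀ s : S, g none + ∑ P : F, g (some P) * (if (s : α) ∈ A P then 1 else 0) = 0 := by
      intro s
      have := congrFun hg s
      simpa [v, Fintype.sum_option] using this
    have hsome : ∀ P : F, g (some P) = 0 := by
      intro P
      have h1 := ev ⟨x P, hx P P.2⟩
      have h2 := ev ⟨y P, hy P P.2⟩
      have h3 : ∑ Q : F, g (some Q) * ((if x P ∈ A Q then 1 else 0) -
          (if y P ∈ A Q then 1 else 0)) = 0 := by
        simp only [mul_sub, Finset.sum_sub_distrib]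
        linarith
      rw [Finset.sum_eq_single P] at h3
      · simpa [hxA P P.2, hyA P P.2] using h3
      · intro Q _ hne
        simp [same P P.2 Q Q.2 (fun e => hne (Subtype.ext e))]
      · simp
    rintro (_ | P)
    · obtain ⟨s, hs⟩ := hS
      simpa [hsome] using ev ⟨s, hs⟩
    · exact hsome P
  have := hv.fintype_card_le_finrank
  simp at this
  omega

theorem IsMinimalSeparating.exists_private_cut {S : Finset α}
    {F : Finset (Finset (Finset α))} (h : IsMinimalSeparating S F) {P : Finset (Finset α)}
    (hP : P ∈ F) :
    ∃ x ∈ S, ∃ y ∈ S, Cuts P x y ∧ ∀ Q ∈ F, Q ≠ P → ¬ Cuts Q x y := by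
  have h1 := h.2 _ (Finset.erase_ssubset hP)
  simp only [IsSeparating] at h1
  push Not at h1
  obtain ⟨x, hx, y, hy, hxy, h2⟩ := h1
  have h3 : ∀ Q ∈ F, Q ≠ P → ¬ Cuts Q x y := fun Q hQ hne => h2 Q (by simp [hQ, hne])
  obtain ⟨Q, hQ, hc⟩ := h.1 x hx y hy hxy
  obtain rfl : Q = P := by_contra fun hne => h3 Q hQ hne hc
  exact ⟨x, hx, y, hy, hc, h3⟩

/-- The bipartition of `S` splitting off the single element `z`. -/
def splitOff (S : Finset α) (z : α) : Finset (Finset α) := {{z}, S.erase z}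

theorem isBipartition_splitOff {S : Finset α} (hS : 2 ≤ S.card) {z : α} (hz : z ∈ S) :
    IsBipartition S (splitOff S z) := by
  have hne : (S.erase z).Nonempty := by
    rw [← Finset.card_pos, Finset.card_erase_of_mem hz]
    omega
  refine ⟨Finset.card_le_two, ?_, ?_, ?_⟩
  · simp [splitOff, hne]
  · simp [splitOff]
  · ext w
    by_cases hw : w = z <;> simp [splitOff, hw, hz]

theorem cuts_splitOff_iff {S : Finset α} {x y z : α} (hx : x ∈ S) (hy : y ∈ S) :
    Cuts (splitOff S z) x y ↔ x ≠ y ∧ (x = z ∨ y = z) := by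
  have hne : ({z} : Finset α) ≠ S.erase z := fun e => by
    have : z ∈ S.erase z := e ▸ Finset.mem_singleton_self z
    simp at this
  simp only [Cuts, splitOff, Finset.mem_insert, Finset.mem_singleton, exists_eq_or_imp,
    exists_eq_left, Finset.mem_erase, hx, hy, ne_eq, hne, hne.symm]
  grind

theorem exists_isMinimalSeparating {S : Finset α} (hS : 2 ≤ S.card) :
    ∃ F : Finset (Finset (Finset α)), (∀ P ∈ F, IsBipartition S P) ∧
      IsMinimalSeparating S F ∧ F.card = S.card - 1 := by
  obtain ⟨a, ha⟩ : S.Nonempty := Finset.card_pos.1 (by omega)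
  have key : ∀ z ∈ S.erase a, ∀ w ∈ S.erase a, Cuts (splitOff S w) a z → w = z := by
    intro z hz w hw h
    have := (cuts_splitOff_iff ha (Finset.mem_of_mem_erase hz)).1 h
    grind
  have cut : ∀ z ∈ S.erase a, Cuts (splitOff S z) a z := fun z hz =>
    (cuts_splitOff_iff ha (Finset.mem_of_mem_erase hz)).2
      ⟨(Finset.ne_of_mem_erase hz).symm, Or.inr rfl⟩
  refine ⟨(S.erase a).image (splitOff S), ?_, ⟨?_, ?_⟩, ?_⟩
  · intro P hP
    obtain ⟨z, hz, rfl⟩ := Finset.mem_image.1 hP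
    exact isBipartition_splitOff hS (Finset.mem_of_mem_erase hz)
  · intro x hx y hy hxy
    by_cases hxa : x = a
    · exact ⟨splitOff S y, Finset.mem_image_of_mem _ (by grind),
        (cuts_splitOff_iff hx hy).2 ⟨hxy, Or.inr rfl⟩⟩
    · exact ⟨splitOff S x, Finset.mem_image_of_mem _ (by grind),
        (cuts_splitOff_iff hx hy).2 ⟨hxy, Or.inl rfl⟩⟩
  · intro G hG hsep
    obtain ⟨P, hP, hPG⟩ := Finset.exists_of_ssubset hG
    obtain ⟨z, hz, rfl⟩ := Finset.mem_image.1 hP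
    obtain ⟨Q, hQ, hc⟩ := hsep a ha z (Finset.mem_of_mem_erase hz)
      (Finset.ne_of_mem_erase hz).symm
    obtain ⟨w, hw, rfl⟩ := Finset.mem_image.1 (hG.1 hQ)
    exact hPG (key z hz w hw hc ▸ hQ)
  · rw [Finset.card_image_of_injOn, Finset.card_erase_of_mem ha]
    intro z hz w hw e
    exact key w hw z hz (by rw [e]; exact cut w hw)

/-- For every finite set `S` with `n ≥ 2` elements, the maximum size of a minimal
separating family of bipartitions for `S` is `n - 1`. -/
theorem maxSize_minimalSeparating {α : Type*} [DecidableEq α] (n : ℕ) (hn : 2 ≤ n)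
    (S : Finset α) (hS : S.card = n) :
    (∀ F : Finset (Finset (Finset α)), (∀ P ∈ F, IsBipartition S P) →
      IsMinimalSeparating S F → F.card ≤ n - 1) ∧
    ∃ F : Finset (Finset (Finset α)), (∀ P ∈ F, IsBipartition S P) ∧
      IsMinimalSeparating S F ∧ F.card = n - 1 := by
  subst hS
  refine ⟨fun F hF hmin => ?_, exists_isMinimalSeparating hn⟩
  have := card_lt_of_private_cuts (Finset.card_pos.1 (by omega)) hF
    fun P hP => hmin.exists_private_cut hP
  omega
end

section
/- For every n ≥ 2, the number of minimal separating families of maximum size n − 1 for an n-element set equals n^(n−2). -/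
open Finset

variable {α : Type*} [DecidableEq α]

/-- `p` is the parent function of a rooted forest with set of roots `R`. -/
def IsForest {V : Type} (R : Finset V) (p : V → V) : Prop :=
  (∀ v ∈ R, p v = v) ∧ ∃ h : V → ℕ, ∀ v ∉ R, h (p v) < h v

theorem IsForest.nonempty {V : Type} [Fintype V] [Nonempty V] {R : Finset V} {p : V → V}
    (hp : IsForest R p) : R.Nonempty := by
  obtain ⟨-, h, hh⟩ := hp
  obtain ⟨v, hv⟩ := Finite.exists_min h
  refine ⟨v, ?_⟩
  by_contra hR
  exact absurd (hv (p v)) (not_le.mpr (hh v hR))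

section Count

open Classical

variable {V : Type} (R : Finset V)

/-- The vertices whose parent is a root. -/
noncomputable def rootChildren [Fintype V] (p : V → V) : Finset {v // v ∉ R} :=
  {v | p v ∈ R}

/-- Assemble a forest from the parents of the children of the roots and from the forest obtained
by deleting the roots. -/
noncomputable def addRoots (W : Finset {v // v ∉ R}) (k : W → R)
    (g : {v // v ∉ R} → {v // v ∉ R}) (v : V) : V :=
  if h : v ∈ R then v else if hW : ⟨v, h⟩ ∈ W then (k ⟨⟨v, h⟩, hW⟩ : V) else g ⟨v, h⟩

variable {R}

theorem addRoots_of_mem {W : Finset {v // v ∉ R}} (k : W → R)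
    (g : {v // v ∉ R} → {v // v ∉ R}) (v : {v // v ∉ R}) (hv : v ∈ W) :
    addRoots R W k g v = k ⟨v, hv⟩ := by
  simp [addRoots, v.2, hv]

theorem addRoots_of_notMem {W : Finset {v // v ∉ R}} (k : W → R)
    (g : {v // v ∉ R} → {v // v ∉ R}) (v : {v // v ∉ R}) (hv : v ∉ W) :
    addRoots R W k g v = g v := by
  simp [addRoots, v.2, hv]

theorem isForest_addRoots {W : Finset {v // v ∉ R}} (k : W → R)
    {g : {v // v ∉ R} → {v // v ∉ R}} (hg : IsForest W g) : IsForest R (addRoots R W k g) := by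
  obtain ⟨-, h, hh⟩ := hg
  refine ⟨fun v hv => by simp [addRoots, hv],
    fun v => if hv : v ∈ R then 0 else h ⟨v, hv⟩ + 1, fun v hv => ?_⟩
  by_cases hW : (⟨v, hv⟩ : {v // v ∉ R}) ∈ W
  · rw [addRoots_of_mem k g ⟨v, hv⟩ hW]
    simp [hv]
  · rw [addRoots_of_notMem k g ⟨v, hv⟩ hW]
    simpa [hv, (g ⟨v, hv⟩).2] using hh _ hW

theorem rootChildren_addRoots [Fintype V] (W : Finset {v // v ∉ R}) (k : W → R)
    (g : {v // v ∉ R} → {v // v ∉ R}) : rootChildren R (addRoots R W k g) = W := by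
  ext v
  by_cases hW : v ∈ W
  · simp [rootChildren, addRoots_of_mem k g v hW, hW]
  · simp [rootChildren, addRoots_of_notMem k g v hW, hW, (g v).2]

theorem exists_addRoots_eq [Fintype V] {p : V → V} (hp : IsForest R p) :
    ∃ (k : rootChildren R p → R) (g : {v // v ∉ R} → {v // v ∉ R}),
      IsForest (rootChildren R p) g ∧ addRoots R (rootChildren R p) k g = p := by
  obtain ⟨hR, h, hh⟩ := hp
  refine ⟨fun v => ⟨p v, by simpa [rootChildren] using v.2⟩,
    fun v => if hv : p v ∈ R then v else ⟨p v, hv⟩, ⟨fun v hv => ?_, fun v => h v, fun v hv => ?_⟩,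
    ?_⟩
  · have : p v ∈ R := by simpa [rootChildren] using hv
    simp [this]
  · have : p v ∉ R := by simpa [rootChildren] using hv
    simpa [this] using hh v v.2
  · funext v
    by_cases hv : v ∈ R
    · simp [addRoots, hv, hR]
    · by_cases hW : p v ∈ R <;> simp [addRoots, hv, hW, rootChildren]

theorem addRoots_injective (W : Finset {v // v ∉ R}) {k k' : W → R}
    {g g' : {v // v ∉ R} → {v // v ∉ R}} (hg : IsForest W g) (hg' : IsForest W g')
    (h : addRoots R W k g = addRoots R W k' g') : k = k' ∧ g = g' := by
  constructor
  · funext v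
    have := congrFun h v
    rw [addRoots_of_mem k g v v.2, addRoots_of_mem k' g' v v.2] at this
    exact Subtype.ext this
  · funext v
    by_cases hv : v ∈ W
    · rw [hg.1 v hv, hg'.1 v hv]
    · have := congrFun h v
      rw [addRoots_of_notMem k g v hv, addRoots_of_notMem k' g' v hv] at this
      exact Subtype.ext this

variable (R) in
theorem card_isForest_eq_sum [Fintype V] :
    Nat.card {p : V → V // IsForest R p} =
      ∑ W : Finset {v // v ∉ R},
        #R ^ #W * Nat.card {g : {v // v ∉ R} → {v // v ∉ R} // IsForest W g} := by
  let e (p : {p : V → V // IsForest R p}) : Finset {v // v ∉ R} := rootChildren R p.1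
  rw [← Nat.card_congr (Equiv.sigmaFiberEquiv e), Nat.card_sigma]
  refine Finset.sum_congr rfl fun W _ => ?_
  let j (q : (W → R) × {g : {v // v ∉ R} → {v // v ∉ R} // IsForest W g}) : {p // e p = W} :=
    ⟨⟨addRoots R W q.1 q.2.1, isForest_addRoots q.1 q.2.2⟩, rootChildren_addRoots W q.1 q.2.1⟩
  have hj : Function.Bijective j := by
    constructor
    · rintro ⟨k, g, hg⟩ ⟨k', g', hg'⟩ h
      have h' : addRoots R W k g = addRoots R W k' g' := congrArg (fun p => p.1.1) h
      obtain ⟨rfl, rfl⟩ := addRoots_injective W hg hg' h'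
      rfl
    · rintro ⟨⟨p, hp⟩, rfl⟩
      obtain ⟨k, g, hg, h⟩ := exists_addRoots_eq hp
      exact ⟨⟨k, g, hg⟩, Subtype.ext (Subtype.ext h)⟩
  rw [← Nat.card_congr (Equiv.ofBijective j hj), Nat.card_prod, Nat.card_fun]
  simp

end Count

theorem sum_choose_mul_pow_mul (m k : ℕ) :
    ∑ i ∈ Finset.range (m + 2), (m + 1).choose i * (k ^ i * (i * (m + 1) ^ (m + 1 - i))) =
      (m + 1) * (k * (m + 1 + k) ^ m) := by
  rw [Finset.sum_range_succ']
  simp only [zero_mul, mul_zero, add_zero]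
  rw [add_comm (m + 1) k, add_pow, Finset.mul_sum, Finset.mul_sum]
  refine Finset.sum_congr rfl fun i _ => ?_
  have h := Nat.add_one_mul_choose_eq m i
  rw [Nat.add_sub_add_right]
  calc _ = ((m + 1).choose (i + 1) * (i + 1)) * (k ^ (i + 1) * (m + 1) ^ (m - i)) := by ring
    _ = _ := by rw [← h]; push_cast; ring

/-- The number of rooted forests on `m + k` vertices with `k` prescribed roots. -/
theorem card_isForest (m : ℕ) : ∀ {V : Type} [Fintype V] (R : Finset V),
    Fintype.card V = m + #R →
      Nat.card {p : V → V // IsForest R p} * (m + #R) = #R * (m + #R) ^ m := by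
  classical
  induction m using Nat.strong_induction_on with
  | _ m ih =>
  intro V _ R hV
  rw [card_isForest_eq_sum]
  have hU : Fintype.card {v // v ∉ R} = m := by
    rw [Fintype.card_subtype_compl]; simp [hV]
  rcases m with _ | m
  · have : IsEmpty {v // v ∉ R} := Fintype.card_eq_zero_iff.mp hU
    have h1 : Nat.card {g : {v // v ∉ R} → {v // v ∉ R} //
        IsForest (∅ : Finset {v // v ∉ R}) g} = 1 := by
      rw [Nat.card_eq_one_iff_unique]
      exact ⟨inferInstance, ⟨⟨id, fun v => isEmptyElim v, fun _ => 0, fun v => isEmptyElim v⟩⟩⟩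
    rw [Fintype.sum_unique]
    have : (default : Finset {v // v ∉ R}) = ∅ := Subsingleton.elim _ _
    rw [this, h1]
    simp
  · have : Nonempty {v // v ∉ R} := Fintype.card_pos_iff.mp (by omega)
    have key : ∀ W : Finset {v // v ∉ R},
        Nat.card {g : {v // v ∉ R} → {v // v ∉ R} // IsForest W g} * (m + 1) =
          #W * (m + 1) ^ (m + 1 - #W) := by
      intro W
      rcases W.eq_empty_or_nonempty with rfl | hW
      · have : IsEmpty {g : {v // v ∉ R} → {v // v ∉ R} // IsForest ∅ g} :=
          ⟨fun g => Finset.not_nonempty_empty g.2.nonempty⟩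
        simp
      · have hle : #W ≤ m + 1 := hU ▸ Finset.card_le_univ W
        have := ih (m + 1 - #W) (by have := hW.card_pos; omega) W (by omega)
        rwa [Nat.sub_add_cancel hle] at this
    have hsum := sum_choose_mul_pow_mul m #R
    have : (∑ W : Finset {v // v ∉ R},
        #R ^ #W * Nat.card {g : {v // v ∉ R} → {v // v ∉ R} // IsForest W g}) * (m + 1) =
        (m + 1) * (#R * (m + 1 + #R) ^ m) := by
      rw [← hsum, Finset.sum_mul]
      simp_rw [mul_assoc, key]
      rw [← Finset.powerset_univ, Finset.sum_powerset_apply_card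
        (fun i => #R ^ i * (i * (m + 1) ^ (m + 1 - i))), Finset.card_univ, hU]
      simp
    rw [mul_comm (m + 1)] at this
    rw [Nat.eq_of_mul_eq_mul_right m.succ_pos this]
    ring

section Split

variable {V : Type} [Fintype V] [DecidableEq V]

/-- The bipartition of the whole type into `A` and its complement. -/
def split (A : Finset V) : Finset (Finset V) := {A, Aᶜ}

theorem cuts_split {A : Finset V} {x y : V} : Cuts (split A) x y ↔ ¬(x ∈ A ↔ y ∈ A) := by
  constructor
  · rintro ⟨B, hB, C, hC, hne, hx, hy⟩
    simp only [split, Finset.mem_insert, Finset.mem_singleton] at hB hC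
    rcases hB with rfl | rfl <;> rcases hC with rfl | rfl <;> simp_all
  · intro h
    have hne : A ≠ Aᶜ := fun hA => by
      have := Finset.ext_iff.mp hA x
      rw [Finset.mem_compl] at this
      tauto
    by_cases hx : x ∈ A
    · exact ⟨A, by simp [split], Aᶜ, by simp [split], hne, hx, by simp_all⟩
    · exact ⟨Aᶜ, by simp [split], A, by simp [split], hne.symm, by simpa using hx, by simp_all⟩

theorem isBipartition_split {A : Finset V} {x y : V} (hx : x ∈ A) (hy : y ∉ A) :
    IsBipartition Finset.univ (split A) := by
  refine ⟨Finset.card_le_two, ?_, ?_, ?_⟩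
  · intro B hB
    simp only [split, Finset.mem_insert, Finset.mem_singleton] at hB
    rcases hB with rfl | rfl
    · exact ⟨x, hx⟩
    · exact ⟨y, by simpa using hy⟩
  · intro B hB C hC hne
    simp only [split, Finset.mem_insert, Finset.mem_singleton] at hB hC
    rcases hB with rfl | rfl <;> rcases hC with rfl | rfl
    · exact absurd rfl hne
    · exact disjoint_compl_right
    · exact disjoint_compl_left
    · exact absurd rfl hne
  · simp [split]

theorem split_injOn {A B : Finset V} {r : V} (hA : r ∉ A) (hB : r ∉ B) (h : split A = split B) :
    A = B := by
  have : A ∈ split B := h ▸ by simp [split]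
  simp only [split, Finset.mem_insert, Finset.mem_singleton] at this
  rcases this with h | rfl
  · exact h
  · simp_all

theorem split_compl (A : Finset V) : split Aᶜ = split A := by
  simp [split, Finset.pair_comm]

theorem IsBipartition.exists_split {P : Finset (Finset V)} (hP : IsBipartition Finset.univ P)
    {x y : V} (h : Cuts P x y) (r : V) :
    ∃ A : Finset V, r ∉ A ∧ P = split A := by
  obtain ⟨hcard, -, hdisj, hsup⟩ := hP
  obtain ⟨A, hA, B, hB, hne, -, -⟩ := h
  have hP : P = {A, B} := by
    symm
    apply Finset.eq_of_subset_of_card_le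
    · intro C hC
      simp only [Finset.mem_insert, Finset.mem_singleton] at hC
      rcases hC with rfl | rfl <;> assumption
    · rwa [Finset.card_pair hne]
  have hAB := hdisj A hA B hB hne
  have hun : A ∪ B = Finset.univ := by simpa [hP] using hsup
  have hBA : B = Aᶜ := by
    ext v
    have h1 : v ∈ A → v ∉ B := fun h => Finset.disjoint_left.mp hAB h
    have h2 := Finset.ext_iff.mp hun v
    simp only [Finset.mem_union, Finset.mem_univ, iff_true] at h2
    rw [Finset.mem_compl]
    tauto
  have hPA : P = split A := by rw [hP, hBA, split]
  by_cases hr : r ∈ A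
  · exact ⟨Aᶜ, by simpa using hr, by rw [split_compl, hPA]⟩
  · exact ⟨A, hr, hPA⟩

end Split

section Descendants

open Classical

variable {V : Type} [Fintype V] {r : V} {p q : V → V}

/-- The descendants of `u` in the forest with parent function `p`, including `u`. -/
noncomputable def descendants (p : V → V) (u : V) : Finset V :=
  {v | ∃ k, p^[k] v = u}

theorem mem_descendants {u v : V} : v ∈ descendants p u ↔ ∃ k, p^[k] v = u := by
  simp [descendants]

theorem self_mem_descendants (u : V) : u ∈ descendants p u :=
  mem_descendants.mpr ⟨0, rfl⟩

theorem mem_descendants_iff {u v : V} :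
    v ∈ descendants p u ↔ v = u ∨ p v ∈ descendants p u := by
  simp only [mem_descendants]
  constructor
  · rintro ⟨k, hk⟩
    rcases k with _ | k
    · exact Or.inl hk
    · exact Or.inr ⟨k, hk⟩
  · rintro (h | ⟨k, hk⟩)
    · exact ⟨0, h⟩
    · exact ⟨k + 1, hk⟩

theorem mem_descendants_trans {u v w : V} (huv : u ∈ descendants p v)
    (hvw : v ∈ descendants p w) : u ∈ descendants p w := by
  rw [mem_descendants] at *
  obtain ⟨k, rfl⟩ := huv
  obtain ⟨l, rfl⟩ := hvw
  exact ⟨l + k, Function.iterate_add_apply p l k u⟩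

theorem root_notMem_descendants (hp : IsForest {r} p) {u : V} (hu : u ≠ r) :
    r ∉ descendants p u := by
  rw [mem_descendants]
  rintro ⟨k, hk⟩
  rw [Function.iterate_fixed (hp.1 r (by simp))] at hk
  exact hu hk.symm

theorem descendants_antisymm (hp : IsForest {r} p) {u v : V} (hu : u ≠ r) (hv : v ≠ r)
    (huv : u ∈ descendants p v) (hvu : v ∈ descendants p u) : u = v := by
  obtain ⟨h, hh⟩ := hp.2
  have key : ∀ {v : V}, v ≠ r → ∀ k u, p^[k] u = v → u = v ∨ h v < h u := by
    intro v hv k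
    induction k with
    | zero => exact fun u hu => Or.inl hu
    | succ k ih =>
      intro u hu
      have hur : u ∉ ({r} : Finset V) := by
        intro hur
        rw [Finset.mem_singleton] at hur
        rw [hur] at hu
        exact root_notMem_descendants hp hv (mem_descendants.mpr ⟨_, hu⟩)
      right
      rcases ih (p u) hu with h1 | h1
      · exact h1 ▸ hh u hur
      · exact h1.trans (hh u hur)
  obtain ⟨k, hk⟩ := mem_descendants.mp huv
  obtain ⟨l, hl⟩ := mem_descendants.mp hvu
  rcases key hv k u hk with h1 | h1
  · exact h1
  · rcases key hu l v hl with h2 | h2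
    · exact h2.symm
    · exact absurd h1 h2.not_gt

theorem parent_notMem_descendants (hp : IsForest {r} p) {u : V} (hu : u ≠ r) :
    p u ∉ descendants p u := by
  intro h
  by_cases hr : p u = r
  · exact root_notMem_descendants hp hu (hr ▸ h)
  · have h1 : u ∈ descendants p (p u) := mem_descendants.mpr ⟨1, rfl⟩
    obtain ⟨f, hf⟩ := hp.2
    have h2 := hf u (by simpa using hu)
    rw [← descendants_antisymm hp hu hr h1 h] at h2
    exact lt_irrefl _ h2

end Descendants

section Family

variable {V : Type} [Fintype V] [DecidableEq V] {r : V} {p q : V → V}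

/-- The fundamental cuts of the tree with root `r` and parent function `p`. -/
noncomputable def fundamentalCuts (r : V) (p : V → V) : Finset (Finset (Finset V)) :=
  ({r}ᶜ : Finset V).image fun u => split (descendants p u)

theorem mem_fundamentalCuts {P : Finset (Finset V)} :
    P ∈ fundamentalCuts r p ↔ ∃ u ≠ r, split (descendants p u) = P := by
  simp [fundamentalCuts]

theorem isBipartition_of_mem_fundamentalCuts (hp : IsForest {r} p) {P : Finset (Finset V)}
    (hP : P ∈ fundamentalCuts r p) : IsBipartition Finset.univ P := by
  obtain ⟨u, hu, rfl⟩ := mem_fundamentalCuts.mp hP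
  exact isBipartition_split (self_mem_descendants u) (root_notMem_descendants hp hu)

theorem card_fundamentalCuts (hp : IsForest {r} p) :
    #(fundamentalCuts r p) = Fintype.card V - 1 := by
  rw [fundamentalCuts, Finset.card_image_of_injOn, Finset.card_compl, Finset.card_singleton]
  intro u hu v hv h
  have hu : u ≠ r := by simpa using hu
  have hv : v ≠ r := by simpa using hv
  have h := split_injOn (root_notMem_descendants hp hu) (root_notMem_descendants hp hv) h
  exact descendants_antisymm hp hu hv (h ▸ self_mem_descendants u) (h ▸ self_mem_descendants v)

theorem isMinimalSeparating_fundamentalCuts (hp : IsForest {r} p) :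
    IsMinimalSeparating Finset.univ (fundamentalCuts r p) := by
  constructor
  · intro x _ y _ hxy
    have key : ∃ u ≠ r, ¬(x ∈ descendants p u ↔ y ∈ descendants p u) := by
      by_contra! h
      by_cases hx : x = r
      · subst hx
        exact root_notMem_descendants hp hxy.symm
          ((h y hxy.symm).mpr (self_mem_descendants y))
      · by_cases hy : y = r
        · subst hy
          exact root_notMem_descendants hp hx ((h x hx).mp (self_mem_descendants x))
        · exact hxy (descendants_antisymm hp hx hy ((h y hy).mpr (self_mem_descendants y))
            ((h x hx).mp (self_mem_descendants x)))
    obtain ⟨u, hu, h⟩ := key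
    exact ⟨_, mem_fundamentalCuts.mpr ⟨u, hu, rfl⟩, cuts_split.mpr h⟩
  · intro F hF hsep
    obtain ⟨P, hP, hPF⟩ := Finset.exists_of_ssubset hF
    obtain ⟨u, hu, rfl⟩ := mem_fundamentalCuts.mp hP
    have hne : u ≠ p u := fun h =>
      parent_notMem_descendants hp hu (h ▸ self_mem_descendants u)
    obtain ⟨Q, hQ, hcut⟩ := hsep u (Finset.mem_univ _) (p u) (Finset.mem_univ _) hne
    obtain ⟨v, hv, rfl⟩ := mem_fundamentalCuts.mp (hF.subset hQ)
    have huv : u ≠ v := by rintro rfl; exact hPF hQ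
    rw [cuts_split, mem_descendants_iff] at hcut
    tauto

theorem fundamentalCuts_injOn (hp : IsForest {r} p) (hq : IsForest {r} q)
    (h : fundamentalCuts r p = fundamentalCuts r q) : p = q := by
  have key : ∀ {p q : V → V}, IsForest {r} p → IsForest {r} q →
      fundamentalCuts r p = fundamentalCuts r q → ∀ u ≠ r,
        descendants q u ⊆ descendants p u := by
    intro p q hp hq h u hu
    have hm : split (descendants p u) ∈ fundamentalCuts r q :=
      h ▸ mem_fundamentalCuts.mpr ⟨u, hu, rfl⟩
    obtain ⟨v, hv, hs⟩ := mem_fundamentalCuts.mp hm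
    have hs := split_injOn (root_notMem_descendants hq hv) (root_notMem_descendants hp hu) hs
    have huv : u ∈ descendants q v := hs ▸ self_mem_descendants u
    rw [← hs]
    exact fun w hw => mem_descendants_trans hw huv
  have heq : ∀ u ≠ r, descendants p u = descendants q u := fun u hu =>
    (key hq hp h.symm u hu).antisymm (key hp hq h u hu)
  have anc : ∀ {p q : V → V}, IsForest {r} p → (∀ u ≠ r, descendants p u = descendants q u) →
      ∀ u ≠ r, p u ≠ r → q u ∈ descendants q (p u) := by
    intro p q hp heq u hu hpu
    have h1 : u ∈ descendants q (p u) := by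
      rw [← heq _ hpu]
      exact mem_descendants.mpr ⟨1, rfl⟩
    rcases mem_descendants_iff.mp h1 with h2 | h2
    · exact absurd (h2 ▸ self_mem_descendants u) (parent_notMem_descendants hp hu)
    · exact h2
  funext u
  by_cases hu : u = r
  · rw [hp.1 u (by simp [hu]), hq.1 u (by simp [hu])]
  have h1 := anc hp heq u hu
  have h2 := anc hq (fun u hu => (heq u hu).symm) u hu
  by_cases hpu : p u = r
  · by_cases hqu : q u = r
    · rw [hpu, hqu]
    · exact absurd (hpu ▸ h2 hqu) (root_notMem_descendants hp hqu)
  · by_cases hqu : q u = r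
    · exact absurd (hqu ▸ h1 hpu) (root_notMem_descendants hq hpu)
    · exact descendants_antisymm hp hpu hqu (h2 hqu) (heq _ hpu ▸ h1 hpu)

/-- Each member of a minimal separating family is the only one to cut some pair `x`, `y`. -/
theorem IsMinimalSeparating.exists_cut {F : Finset (Finset (Finset V))}
    (hbip : ∀ P ∈ F, IsBipartition Finset.univ P) (hF : IsMinimalSeparating Finset.univ F) (r : V)
    {P : Finset (Finset V)} (hP : P ∈ F) :
    ∃ (A : Finset V) (x y : V), P = split A ∧ r ∉ A ∧ x ∉ A ∧ y ∈ A ∧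
      ∀ Q ∈ F, Q ≠ P → ¬Cuts Q x y := by
  have h := hF.2 _ (Finset.erase_ssubset hP)
  simp only [IsSeparating] at h
  push Not at h
  obtain ⟨x, -, y, -, hxy, h⟩ := h
  have h : ∀ Q ∈ F, Q ≠ P → ¬Cuts Q x y := fun Q hQ hne =>
    h Q (Finset.mem_erase.mpr ⟨hne, hQ⟩)
  obtain ⟨Q, hQ, hcut⟩ := hF.1 x (Finset.mem_univ _) y (Finset.mem_univ _) hxy
  have : Q = P := by
    by_contra hne
    exact h Q hQ hne hcut
  subst this
  obtain ⟨A, hr, rfl⟩ := (hbip Q hQ).exists_split hcut r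
  by_cases hx : x ∈ A
  · refine ⟨A, y, x, rfl, hr, by rw [cuts_split] at hcut; tauto, hx, fun R hR hne hc => h R hR hne ?_⟩
    obtain ⟨B, hB, C, hC, hBC, hyB, hxC⟩ := hc
    exact ⟨C, hC, B, hB, hBC.symm, hxC, hyB⟩
  · exact ⟨A, x, y, rfl, hr, hx, by rw [cuts_split] at hcut; tauto, h⟩

/-- Suppose that each set of a family of `|V| - 1` subsets avoiding `r` is the only one to separate
`x i ∉ A i` from `y i ∈ A i`. Then the matrices of membership and of signed incidence of the
pairs `x i`, `y i` are inverse to each other, here in terms of counts. -/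
theorem card_sub_card_eq {ι : Type} [Fintype ι] [DecidableEq ι] (hι : Fintype.card ι + 1 = Fintype.card V)
    {A : ι → Finset V} {x y : ι → V} (hr : ∀ i, r ∉ A i) (hx : ∀ i, x i ∉ A i)
    (hy : ∀ i, y i ∈ A i) (hxy : ∀ i j, i ≠ j → (x i ∈ A j ↔ y i ∈ A j)) {u v : V} (hu : u ≠ r)
    (hv : v ≠ r) :
    ((#{i | y i = u ∧ v ∈ A i} : ℕ) : ℤ) - #{i | x i = u ∧ v ∈ A i} = if u = v then 1 else 0 := by
  let M : Matrix ι {v // v ≠ r} ℤ := fun i v => if v.1 ∈ A i then 1 else 0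
  let N : Matrix {v // v ≠ r} ι ℤ := fun v i =>
    (if y i = v.1 then 1 else 0) - (if x i = v.1 then 1 else 0)
  have hsum : ∀ (a : V) (i : ι), ∑ v : {v // v ≠ r},
      (if v.1 ∈ A i then 1 else 0) * (if a = v.1 then 1 else 0) =
        if a ∈ A i then (1 : ℤ) else 0 := by
    intro a i
    by_cases ha : a = r
    · subst ha
      rw [if_neg (hr i)]
      exact Finset.sum_eq_zero fun v _ => by simp [v.2.symm]
    · rw [Finset.sum_eq_single ⟨a, ha⟩]
      · simp
      · intro b _ hb
        have : a ≠ b.1 := fun h => hb (Subtype.ext h.symm)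
        simp [this]
      · simp
  have hMN : M * N = 1 := by
    ext i j
    rw [Matrix.mul_apply, Matrix.one_apply]
    simp only [M, N, mul_sub, Finset.sum_sub_distrib, hsum]
    by_cases hij : i = j
    · subst hij
      simp [hx, hy]
    · simp [hij, hxy j i (Ne.symm hij)]
  have hcard : Fintype.card ι = Fintype.card {v // v ≠ r} := by
    rw [Fintype.card_subtype_compl]
    simp
    omega
  rw [Matrix.mul_eq_one_comm_of_card_eq _ _ _ hcard] at hMN
  have := congrFun (congrFun hMN ⟨u, hu⟩) ⟨v, hv⟩
  rw [Matrix.mul_apply, Matrix.one_apply] at this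
  simp only [M, N, sub_mul, Finset.sum_sub_distrib, Subtype.mk.injEq] at this
  rw [← this]
  simp_rw [ite_zero_mul_ite_zero]
  simp

theorem exists_fundamentalCuts_eq [Nontrivial V] {F : Finset (Finset (Finset V))}
    (hbip : ∀ P ∈ F, IsBipartition Finset.univ P) (hF : IsMinimalSeparating Finset.univ F)
    (hcard : #F + 1 = Fintype.card V) (r : V) :
    ∃ p, IsForest {r} p ∧ fundamentalCuts r p = F := by
  choose A x y hA hr hx hy hQ using fun P : F => hF.exists_cut hbip r P.2
  have hxy : ∀ i j, i ≠ j → (x i ∈ A j ↔ y i ∈ A j) := by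
    intro i j hij
    have := hQ i j j.2 (fun h => hij (Subtype.ext h.symm))
    rw [hA j, cuts_split] at this
    exact not_not.mp this
  have hsum := fun {u v : V} => card_sub_card_eq (u := u) (v := v) (by simpa using hcard) hr hx hy hxy
  have hyr : ∀ i, y i ≠ r := fun i h => hr i (h ▸ hy i)
  have huniq : ∀ u ≠ r, ∃ i, y i = u ∧ ∀ j, y j = u → j = i := by
    intro u hu
    have h := hsum hu hu
    have h0 : #{i | x i = u ∧ u ∈ A i} = 0 := by
      rw [Finset.card_eq_zero, Finset.filter_eq_empty_iff]
      rintro i - ⟨rfl, h⟩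
      exact hx i h
    rw [h0, if_pos rfl] at h
    have h1 : #{i | y i = u ∧ u ∈ A i} = 1 := by
      simpa using h
    obtain ⟨i, hi⟩ := Finset.card_eq_one.mp h1
    have hi' := fun j => Finset.ext_iff.mp hi j
    simp only [Finset.mem_filter_univ, Finset.mem_singleton] at hi'
    refine ⟨i, ((hi' i).mpr rfl).1, fun j hj => (hi' j).mp ⟨hj, hj ▸ hy j⟩⟩
  have hinj : Function.Injective y := fun i j hij => by
    obtain ⟨k, -, hk⟩ := huniq (y j) (hyr j)
    rw [hk i hij, hk j rfl]
  have : Nonempty F := by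
    obtain ⟨u, hu⟩ := exists_ne r
    exact ⟨(huniq u hu).choose⟩
  choose! e he heu using huniq
  have hey : ∀ i, e (y i) = i := fun i => (heu _ (hyr i) i rfl).symm
  have hchild : ∀ i, ∀ v ∈ A i, v ≠ y i → ∃ j, x j = y i ∧ v ∈ A j := by
    intro i v hv hne
    have hvr : v ≠ r := by rintro rfl; exact hr i hv
    have h := hsum (hyr i) hvr
    rw [if_neg hne.symm, sub_eq_zero, Nat.cast_inj] at h
    have : 0 < #{j | y j = y i ∧ v ∈ A j} := Finset.card_pos.mpr ⟨i, by simp [hv]⟩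
    rw [h, Finset.card_pos] at this
    obtain ⟨j, hj⟩ := this
    exact ⟨j, by simpa using hj⟩
  have hsub : ∀ i j, x j = y i → A j ⊆ A i := by
    intro i j hij v hv
    have hvr : v ≠ r := by rintro rfl; exact hr j hv
    by_cases hne : v = y i
    · exact hne ▸ hy i
    have h := hsum (hyr i) hvr
    rw [if_neg (Ne.symm hne), sub_eq_zero, Nat.cast_inj] at h
    have : 0 < #{j | x j = y i ∧ v ∈ A j} := Finset.card_pos.mpr ⟨j, by simp [hv, hij]⟩
    rw [← h, Finset.card_pos] at this
    obtain ⟨k, hk⟩ := this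
    simp only [Finset.mem_filter_univ] at hk
    exact hinj hk.1 ▸ hk.2
  have hssub : ∀ i j, x j = y i → A j ⊂ A i := fun i j hij =>
    (Finset.ssubset_iff_of_subset (hsub i j hij)).mpr ⟨y i, hy i, hij ▸ hx j⟩
  let p : V → V := fun v => if v = r then r else x (e v)
  have hpy : ∀ i, p (y i) = x i := fun i => by simp [p, hyr, hey]
  have hp : IsForest {r} p := by
    refine ⟨fun v hv => by simp [p, Finset.mem_singleton.mp hv],
      fun v => if v = r then 0 else Fintype.card V + 1 - #(A (e v)), fun v hv => ?_⟩
    have hv : v ≠ r := by simpa using hv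
    obtain ⟨i, rfl⟩ : ∃ i, y i = v := ⟨e v, he v hv⟩
    have hi := Finset.card_le_univ (A i)
    simp only [hpy, hey, hyr, if_false]
    split_ifs with hxr
    · omega
    · have := Finset.card_lt_card (hssub (e (x i)) i (he _ hxr).symm)
      omega
  have hdesc : ∀ i, descendants p (y i) = A i := by
    intro i
    ext v
    constructor
    · intro hv
      obtain ⟨k, hk⟩ := mem_descendants.mp hv
      clear hv
      induction k generalizing v with
      | zero =>
        obtain rfl : v = y i := hk
        exact hy i
      | succ k ih =>
        have hpv := ih (p v) hk
        by_cases hvr : v = r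
        · simp only [hvr, p, if_true] at hpv
          exact absurd hpv (hr i)
        · obtain ⟨j, rfl⟩ : ∃ j, y j = v := ⟨e v, he v hvr⟩
          rw [hpy] at hpv
          by_cases hij : j = i
          · exact hij ▸ hy j
          · exact (hxy j i hij).mp hpv
    · intro hv
      induction hn : #(A i) using Nat.strong_induction_on generalizing i with
      | _ n ih =>
      by_cases hne : v = y i
      · exact hne ▸ self_mem_descendants _
      · obtain ⟨j, hj, hvj⟩ := hchild i v hv hne
        have := ih _ (hn ▸ Finset.card_lt_card (hssub i j hj)) j hvj rfl
        refine mem_descendants_trans this (mem_descendants.mpr ⟨1, ?_⟩)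
        simp [hpy, hj]
  refine ⟨p, hp, ?_⟩
  ext P
  rw [mem_fundamentalCuts]
  constructor
  · rintro ⟨u, hu, rfl⟩
    rw [← he u hu, hdesc, ← hA]
    exact (e u).2
  · intro hP
    exact ⟨y ⟨P, hP⟩, hyr _, by rw [hdesc, ← hA]⟩

end Family

/-- The number of minimal separating families of maximum size `n - 1` for an
`n`-element set is `n ^ (n - 2)`. -/
theorem card_minimalSeparating (n : ℕ) (hn : 2 ≤ n) :
    Set.ncard {F : Finset (Finset (Finset (Fin n))) |
      (∀ P ∈ F, IsBipartition Finset.univ P) ∧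
        IsMinimalSeparating Finset.univ F ∧ F.card = n - 1} = n ^ (n - 2) := by
  let r : Fin n := ⟨0, by omega⟩
  have : Nontrivial (Fin n) := Fin.nontrivial_iff_two_le.mpr hn
  have himage : {F : Finset (Finset (Finset (Fin n))) |
      (∀ P ∈ F, IsBipartition Finset.univ P) ∧
        IsMinimalSeparating Finset.univ F ∧ F.card = n - 1} =
      fundamentalCuts r '' {p | IsForest {r} p} := by
    ext F
    constructor
    · rintro ⟨hbip, hF, hcard⟩
      exact exists_fundamentalCuts_eq hbip hF (by rw [hcard, Fintype.card_fin]; omega) r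
    · rintro ⟨p, hp, rfl⟩
      exact ⟨fun P hP => isBipartition_of_mem_fundamentalCuts hp hP,
        isMinimalSeparating_fundamentalCuts hp, by
          rw [card_fundamentalCuts hp, Fintype.card_fin]⟩
  have hinj : Set.InjOn (fundamentalCuts r) {p | IsForest {r} p} := fun p hp q hq h =>
    fundamentalCuts_injOn hp hq h
  rw [himage, hinj.ncard_image]
  obtain ⟨m, rfl⟩ := Nat.exists_eq_add_of_le' hn
  have h := card_isForest (m + 1) {r} (by simp)
  rw [Finset.card_singleton, one_mul, pow_succ] at h
  exact Nat.eq_of_mul_eq_mul_right (Nat.succ_pos _) h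
end

section
/- For all n, k with 2 ≤ n and 1 ≤ k ≤ 2^(n−1), the following identity holds: ∑_{i=1}^{k} i! · S(k, i) · τ_{n,i} = (2^k − 1)(2^k − 2)⋯(2^k − n + 1), where S(k, i) denotes the Stirling number of the second kind (the number of partitions of a k-element set into i nonempty subsets). -/
open Finset

variable {α : Type*} [DecidableEq α]

/-- `tauSep n k` is the number of separating families consisting of `k` arbitrary
bipartitions of an `n`-element set. -/
noncomputable def tauSep (n k : ℕ) : ℕ :=
  Set.ncard {F : Finset (Finset (Finset (Fin n))) |
    (∀ P ∈ F, IsBipartition Finset.univ P) ∧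
      IsSeparating Finset.univ F ∧ F.card = k}

/-- The Stirling numbers of the second kind: `stirling2 n k` is the number of
partitions of an `n`-element set into `k` nonempty subsets. -/
def stirling2 : ℕ → ℕ → ℕ
  | 0, 0 => 1
  | 0, _ + 1 => 0
  | _ + 1, 0 => 0
  | n + 1, k + 1 => (k + 1) * stirling2 n (k + 1) + stirling2 n k

lemma card_filter_image_eq {β : Type*} [Fintype β] [DecidableEq β] (k : ℕ) (F : Finset β) :
    #{f : Fin k → β | univ.image f = F} = (#F).factorial * stirling2 k #F := by
  induction k generalizing F with
  | zero =>
    rcases F.eq_empty_or_nonempty with rfl | hF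
    · simp [stirling2]
    · obtain ⟨c, hc⟩ := Nat.exists_eq_succ_of_ne_zero hF.card_ne_zero
      simp [hc, stirling2, hF.ne_empty.symm]
  | succ k ih =>
    have hinsert (f : Fin (k + 1) → β) :
        univ.image f = insert (f 0) (univ.image (Fin.tail f)) := by
      ext b
      simp [Fin.exists_fin_succ, Fin.tail, eq_comm]
    have hiff (a : β) (G : Finset β) :
        insert a G = F ↔ a ∈ F ∧ (G = F ∨ G = F.erase a) := by
      constructor
      · rintro rfl
        by_cases ha : a ∈ G <;> simp [ha]
      · rintro ⟨ha, rfl | rfl⟩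
        · exact insert_eq_self.2 ha
        · exact insert_erase ha
    have hcount : #{f : Fin (k + 1) → β | univ.image f = F} =
        ∑ a ∈ F, #{g : Fin k → β | univ.image g = F ∨ univ.image g = F.erase a} := by
      rw [← card_sigma]
      refine card_bij' (fun f _ ↦ ⟨f 0, Fin.tail f⟩) (fun p _ ↦ Fin.cons p.1 p.2) ?_ ?_ ?_ ?_
      · intro f hf
        simpa [hinsert, hiff] using hf
      · intro p hp
        simpa [hinsert, hiff] using hp
      · intro f _
        exact Fin.cons_self_tail f
      · intro p _
        simp
    have hsplit (a : β) (ha : a ∈ F) :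
        #{g : Fin k → β | univ.image g = F ∨ univ.image g = F.erase a} =
          (#F).factorial * stirling2 k #F + (#F - 1).factorial * stirling2 k (#F - 1) := by
      rw [filter_or, card_union_of_disjoint, ih, ih, card_erase_of_mem ha]
      refine disjoint_filter.2 fun g _ h h2 ↦ ?_
      exact (erase_ne_self.2 ha) (h2.symm.trans h)
    rw [hcount, sum_congr rfl hsplit, sum_const, smul_eq_mul]
    cases #F with
    | zero => simp [stirling2]
    | succ c =>
      simp only [stirling2, Nat.factorial_succ, Nat.add_sub_cancel]
      ring

lemma card_filter_image {β : Type*} [Fintype β] [DecidableEq β] (k : ℕ)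
    (Q : Finset β → Prop) [DecidablePred Q] :
    #{f : Fin k → β | Q (univ.image f)} =
      ∑ i ∈ range (k + 1), i.factorial * stirling2 k i * #{F : Finset β | Q F ∧ #F = i} := by
  have hmaps : ∀ f ∈ ({f : Fin k → β | Q (univ.image f)} : Finset (Fin k → β)),
      univ.image f ∈ ({F : Finset β | Q F ∧ #F ∈ range (k + 1)} : Finset (Finset β)) := by
    intro f hf
    have := (card_image_le (f := f) (s := univ)).trans_eq (card_fin k)
    simp_all
  have hfib : ∀ F ∈ ({F : Finset β | Q F ∧ #F ∈ range (k + 1)} : Finset (Finset β)),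
      #{f ∈ ({f : Fin k → β | Q (univ.image f)} : Finset (Fin k → β)) | univ.image f = F} =
        (#F).factorial * stirling2 k #F := by
    intro F hF
    rw [← card_filter_image_eq, filter_filter]
    congr 1
    ext f
    simp only [mem_filter, mem_univ, true_and] at hF ⊢
    exact ⟨And.right, fun h ↦ ⟨h ▸ hF.1, h⟩⟩
  rw [card_eq_sum_card_fiberwise hmaps, sum_congr rfl hfib,
    ← sum_fiberwise_of_maps_to (t := range (k + 1)) (g := fun F : Finset β ↦ #F)
      (fun F hF ↦ (mem_filter.1 hF).2.2)]
  refine sum_congr rfl fun i hi ↦ ?_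
  rw [filter_filter, mul_comm, ← smul_eq_mul, ← sum_const]
  refine sum_congr ?_ ?_
  · ext F
    simp only [mem_filter, mem_univ, true_and]
    constructor
    · rintro ⟨⟨h, -⟩, h2⟩
      exact ⟨h, h2⟩
    · rintro ⟨h, rfl⟩
      exact ⟨⟨h, hi⟩, rfl⟩
  · intro F hF
    rw [(mem_filter.1 hF).2.2]

/-- The bipartition whose components are the nonempty ones among `A` and its complement. -/
def bipartitionOf {β : Type*} [Fintype β] [DecidableEq β] (A : Finset β) :
    Finset (Finset β) :=
  ({A, Aᶜ} : Finset (Finset β)).erase ∅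

lemma mem_bipartitionOf {β : Type*} [Fintype β] [DecidableEq β] {A B : Finset β} :
    B ∈ bipartitionOf A ↔ B.Nonempty ∧ (B = A ∨ B = Aᶜ) := by
  simp [bipartitionOf, nonempty_iff_ne_empty]

lemma isBipartition_bipartitionOf {β : Type*} [Fintype β] [DecidableEq β] (A : Finset β) :
    IsBipartition univ (bipartitionOf A) := by
  refine ⟨(card_erase_le).trans card_le_two, fun B hB ↦ (mem_bipartitionOf.1 hB).1, ?_, ?_⟩
  · intro B hB C hC hne
    obtain ⟨-, rfl | rfl⟩ := mem_bipartitionOf.1 hB <;>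
      obtain ⟨-, rfl | rfl⟩ := mem_bipartitionOf.1 hC
    · exact absurd rfl hne
    · exact disjoint_compl_right
    · exact disjoint_compl_left
    · exact absurd rfl hne
  · refine eq_univ_iff_forall.2 fun x ↦ mem_sup.2 ?_
    by_cases hx : x ∈ A
    · exact ⟨A, mem_bipartitionOf.2 ⟨⟨x, hx⟩, Or.inl rfl⟩, hx⟩
    · exact ⟨Aᶜ, mem_bipartitionOf.2 ⟨⟨x, mem_compl.2 hx⟩, Or.inr rfl⟩, mem_compl.2 hx⟩

lemma cuts_bipartitionOf {β : Type*} [Fintype β] [DecidableEq β] {A : Finset β} {x y : β} :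
    Cuts (bipartitionOf A) x y ↔ ¬(x ∈ A ↔ y ∈ A) := by
  constructor
  · rintro ⟨B, hB, C, hC, hne, hx, hy⟩
    obtain ⟨-, rfl | rfl⟩ := mem_bipartitionOf.1 hB <;>
      obtain ⟨-, rfl | rfl⟩ := mem_bipartitionOf.1 hC <;> simp_all
  · intro h
    by_cases hx : x ∈ A
    · have hy : y ∈ Aᶜ := by simp_all
      exact ⟨A, mem_bipartitionOf.2 ⟨⟨x, hx⟩, Or.inl rfl⟩,
        Aᶜ, mem_bipartitionOf.2 ⟨⟨y, hy⟩, Or.inr rfl⟩,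
        fun he ↦ mem_compl.1 (he ▸ hx) hx, hx, hy⟩
    · have hy : y ∈ A := by simp_all
      exact ⟨Aᶜ, mem_bipartitionOf.2 ⟨⟨x, mem_compl.2 hx⟩, Or.inr rfl⟩,
        A, mem_bipartitionOf.2 ⟨⟨y, hy⟩, Or.inl rfl⟩,
        fun he ↦ hx (he ▸ mem_compl.2 hx), mem_compl.2 hx, hy⟩

lemma eq_of_bipartitionOf_eq {β : Type*} [Fintype β] [DecidableEq β] {A B : Finset β} {x : β}
    (hA : x ∉ A) (hB : x ∉ B) (h : bipartitionOf A = bipartitionOf B) : A = B := by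
  ext y
  have := cuts_bipartitionOf (A := A) (x := x) (y := y)
  rw [h, cuts_bipartitionOf] at this
  simp_all

lemma IsBipartition.exists_eq_bipartitionOf {β : Type*} [Fintype β] [DecidableEq β]
    {P : Finset (Finset β)} (hP : IsBipartition univ P) (x : β) :
    ∃ A, x ∉ A ∧ bipartitionOf A = P := by
  obtain ⟨hcard, hne, hdisj, hsup⟩ := hP
  have hcover (y : β) : ∃ C ∈ P, y ∈ C := by
    simpa using mem_sup.1 (hsup ▸ mem_univ y : y ∈ P.sup id)
  obtain ⟨C, hC, hxC⟩ := hcover x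
  have hcompl (D : Finset β) (hD : D ∈ P) (hDC : D ≠ C) : D = Cᶜ := by
    ext y
    rw [mem_compl]
    refine ⟨fun hy hyC ↦ disjoint_left.1 (hdisj D hD C hC hDC) hy hyC, fun hy ↦ ?_⟩
    obtain ⟨E, hE, hyE⟩ := hcover y
    by_cases hED : E = D
    · exact hED ▸ hyE
    · have hEC : E ≠ C := fun h ↦ hy (h ▸ hyE)
      have hsub : {C, D, E} ⊆ P := by simp [insert_subset_iff, *]
      have := card_le_card hsub
      rw [card_eq_three.2 ⟨C, D, E, hDC.symm, hEC.symm, Ne.symm hED, rfl⟩] at this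
      omega
  refine ⟨Cᶜ, by simpa using hxC, ?_⟩
  ext D
  rw [mem_bipartitionOf, compl_compl]
  constructor
  · rintro ⟨⟨y, hy⟩, rfl | rfl⟩
    · obtain ⟨E, hE, hyE⟩ := hcover y
      exact hcompl E hE (fun h ↦ mem_compl.1 hy (h ▸ hyE)) ▸ hE
    · exact hC
  · intro hD
    refine ⟨hne D hD, ?_⟩
    by_cases hDC : D = C
    · exact Or.inr hDC
    · exact Or.inl (hcompl D hD hDC)

open Classical in
lemma card_separating_sequences (m k : ℕ) :
    #{f : Fin k → Finset (Finset (Fin (m + 1))) |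
      (∀ P ∈ univ.image f, IsBipartition univ P) ∧ IsSeparating univ (univ.image f)} =
      (2 ^ k - 1).descFactorial m := by
  have hcard : Fintype.card (Fin m ↪ {v : Finset (Fin k) // v ≠ ∅}) =
      (2 ^ k - 1).descFactorial m := by
    rw [Fintype.card_embedding_eq, Fintype.card_subtype_compl]
    simp
  let A (e : Fin m ↪ {v : Finset (Fin k) // v ≠ ∅}) (j : Fin k) : Finset (Fin (m + 1)) :=
    {i : Fin m | j ∈ (e i).1}.toFinset.map (Fin.succEmb m)
  have hA0 (e j) : 0 ∉ A e j := by simp [A]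
  have hAs (e j i) : Fin.succ i ∈ A e j ↔ j ∈ (e i).1 := by simp [A]
  rw [← hcard, ← card_univ]
  symm
  refine card_bij (fun e _ j ↦ bipartitionOf (A e j)) ?_ ?_ ?_
  · intro e _
    simp only [mem_filter, mem_univ, true_and, mem_image, forall_exists_index,
      forall_apply_eq_imp_iff]
    refine ⟨fun j ↦ isBipartition_bipartitionOf _, fun x _ y _ hxy ↦ ?_⟩
    suffices h : ∃ j, ¬(x ∈ A e j ↔ y ∈ A e j) by
      obtain ⟨j, hj⟩ := h
      exact ⟨_, mem_image_of_mem _ (mem_univ j), cuts_bipartitionOf.2 hj⟩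
    cases x using Fin.cases with
    | zero =>
      cases y using Fin.cases with
      | zero => exact absurd rfl hxy
      | succ i =>
        obtain ⟨j, hj⟩ := nonempty_iff_ne_empty.2 (e i).2
        exact ⟨j, by simp [hA0, hAs, hj]⟩
    | succ i =>
      cases y using Fin.cases with
      | zero =>
        obtain ⟨j, hj⟩ := nonempty_iff_ne_empty.2 (e i).2
        exact ⟨j, by simp [hA0, hAs, hj]⟩
      | succ l =>
        by_contra! h
        refine hxy (congrArg Fin.succ (e.injective (Subtype.ext ?_)))
        ext j
        rw [← hAs, ← hAs]
        exact h j
  · intro e _ e2 _ h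
    ext i j
    rw [← hAs, ← hAs, eq_of_bipartitionOf_eq (hA0 e j) (hA0 e2 j) (congrFun h j)]
  · intro f hf
    simp only [mem_filter, mem_univ, true_and, mem_image, forall_exists_index,
      forall_apply_eq_imp_iff] at hf
    obtain ⟨hbip, hsep⟩ := hf
    choose B hB0 hB using fun j ↦ (hbip j).exists_eq_bipartitionOf 0
    have hcut (x y : Fin (m + 1)) (hxy : x ≠ y) : ∃ j, ¬(x ∈ B j ↔ y ∈ B j) := by
      obtain ⟨P, hP, hc⟩ := hsep x (mem_univ x) y (mem_univ y) hxy
      obtain ⟨j, -, rfl⟩ := mem_image.1 hP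
      rw [← hB, cuts_bipartitionOf] at hc
      exact ⟨j, hc⟩
    let e : Fin m ↪ {v : Finset (Fin k) // v ≠ ∅} :=
      { toFun := fun i ↦ ⟨({j | i.succ ∈ B j} : Finset (Fin k)), by
          obtain ⟨j, hj⟩ := hcut 0 i.succ (Fin.succ_ne_zero i).symm
          refine nonempty_iff_ne_empty.1 ⟨j, ?_⟩
          simpa [hB0] using hj⟩
        inj' := by
          intro i l h
          by_contra hil
          obtain ⟨j, hj⟩ := hcut i.succ l.succ (fun h2 ↦ hil (Fin.succ_injective _ h2))
          refine hj ?_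
          simpa using Finset.ext_iff.1 (Subtype.ext_iff.1 h) j }
    refine ⟨e, mem_univ _, funext fun j ↦ ?_⟩
    rw [← hB j]
    congr 1
    ext x
    cases x using Fin.cases with
    | zero => simp [hA0, hB0]
    | succ i =>
      rw [hAs]
      exact mem_filter_univ j

lemma cast_descFactorial_two_pow_sub_one (m k : ℕ) :
    (((2 ^ k - 1).descFactorial m : ℕ) : ℤ) = ∏ j ∈ Icc 1 m, ((2 : ℤ) ^ k - (j : ℤ)) := by
  rw [← descPochhammer_eval_eq_descFactorial, descPochhammer_eval_eq_prod_range,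
    ← Ico_add_one_right_eq_Icc, prod_Ico_eq_prod_range]
  refine prod_congr rfl fun j _ ↦ ?_
  push_cast [Nat.one_le_two_pow]
  ring

/-- For `2 ≤ n` and `1 ≤ k ≤ 2 ^ (n - 1)`:
`∑_{i=1}^{k} i! · S(k, i) · τ_{n,i} = (2^k − 1)(2^k − 2) ⋯ (2^k − n + 1)`. -/
theorem sum_stirling2_tauSep (n k : ℕ) (hn : 2 ≤ n) (hk1 : 1 ≤ k)
    (hk2 : k ≤ 2 ^ (n - 1)) :
    ∑ i ∈ Finset.Icc 1 k,
        (i.factorial : ℤ) * (stirling2 k i : ℤ) * (tauSep n i : ℤ) =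
      ∏ j ∈ Finset.Icc 1 (n - 1), ((2 : ℤ) ^ k - (j : ℤ)) := by
  classical
  obtain ⟨m, rfl⟩ := Nat.exists_eq_add_of_le' (one_le_two.trans hn)
  have htau (i : ℕ) : tauSep (m + 1) i =
      #{F : Finset (Finset (Finset (Fin (m + 1)))) |
        ((∀ P ∈ F, IsBipartition univ P) ∧ IsSeparating univ F) ∧ #F = i} := by
    rw [tauSep, ← Set.ncard_coe_finset]
    simp [and_assoc]
  have hsum := card_filter_image k fun F : Finset (Finset (Finset (Fin (m + 1)))) ↦
    (∀ P ∈ F, IsBipartition univ P) ∧ IsSeparating univ F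
  rw [card_separating_sequences] at hsum
  rw [Nat.add_sub_cancel, ← cast_descFactorial_two_pow_sub_one, hsum, sum_range_succ',
    ← Ico_add_one_right_eq_Icc, sum_Ico_eq_sum_range]
  obtain ⟨l, rfl⟩ := Nat.exists_eq_add_of_le' hk1
  simp [htau, stirling2, add_comm 1]
end

section
/- For all n, k with 2 ≤ n and 1 ≤ k ≤ 2^(n−1), the number τ_{n,k} of separating families of k arbitrary bipartitions of an n-element set satisfies τ_{n,k} = ((n−1)!/k!) · ∑_{i=1}^{k} (−1)^(k−i) · c(k, i) · C(2^i − 1, n − 1), where c(k, i) is the unsigned Stirling number of the first kind and C(·,·) is the binomial coefficient. -/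
open Finset

variable {α : Type*} [DecidableEq α]

/-- The unsigned Stirling numbers of the first kind: `stirling1 n k` is the number of
permutations of an `n`-element set with exactly `k` cycles. -/
def stirling1 : ℕ → ℕ → ℕ
  | 0, 0 => 1
  | 0, _ + 1 => 0
  | _ + 1, 0 => 0
  | n + 1, k + 1 => n * stirling1 n (k + 1) + stirling1 n k

theorem stirling1_eq_zero_of_lt : ∀ {n k : ℕ}, n < k → stirling1 n k = 0
  | 0, _ + 1, _ => rfl
  | n + 1, k + 1, h => by
    have h1 : n < k + 1 := by omega
    have h2 : n < k := by omega
    simp [stirling1, stirling1_eq_zero_of_lt h1, stirling1_eq_zero_of_lt h2]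

theorem mul_stirling1_zero (k : ℕ) : k * stirling1 k 0 = 0 := by
  cases k <;> simp [stirling1]

/-- The signed Stirling numbers of the first kind expand the falling factorial. -/
theorem sum_stirling1_mul_pow {R : Type*} [CommRing R] (x : R) (k : ℕ) :
    ∑ i ∈ range (k + 1), (-1 : R) ^ (k + i) * (stirling1 k i : R) * x ^ i =
      ∏ j ∈ range k, (x - j) := by
  induction k with
  | zero => simp [stirling1]
  | succ k ih =>
    have hshift : (k : R) * ∑ i ∈ range (k + 1),
        (-1 : R) ^ (k + (i + 1)) * (stirling1 k (i + 1) : R) * x ^ (i + 1) =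
        k * ∏ j ∈ range k, (x - j) := by
      have h := sum_range_succ'
        (fun i => (-1 : R) ^ (k + i) * (stirling1 k i : R) * x ^ i) (k + 1)
      rw [sum_range_succ, stirling1_eq_zero_of_lt (Nat.lt_succ_self k), ih] at h
      have h0 : (k : R) * (stirling1 k 0 : R) = 0 := by
        exact_mod_cast congrArg (Nat.cast : ℕ → R) (mul_stirling1_zero k)
      simp only [Nat.cast_zero, mul_zero, zero_mul, add_zero, pow_zero, mul_one] at h
      rw [h]
      linear_combination -((-1 : R) ^ k) * h0
    rw [prod_range_succ, sum_range_succ', ← ih]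
    rw [← ih] at hshift
    simp only [stirling1, Nat.cast_zero, mul_zero, zero_mul, add_zero]
    rw [mul_sub, mul_comm _ (k : R), ← hshift, sum_mul, mul_sum, ← sum_sub_distrib]
    refine sum_congr rfl fun i _ => ?_
    push_cast
    ring

theorem eq_of_sum_powerset_eq {X M : Type*} [AddCommGroup M] {u v : Finset X → M}
    (h : ∀ F : Finset X, ∑ T ∈ F.powerset, u T = ∑ T ∈ F.powerset, v T) : u = v := by
  classical
  funext F
  induction F using Finset.strongInduction with
  | H F ih =>
    have hF := h F
    rw [← insert_erase (mem_powerset_self F), sum_insert (notMem_erase _ _),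
      sum_insert (notMem_erase _ _)] at hF
    rw [sum_congr rfl fun T hT => ih T ?_] at hF
    · exact add_right_cancel hF
    · rw [mem_erase, mem_powerset] at hT
      exact hT.2.ssubset_of_ne hT.1

section Surjections

variable {X : Type*} [Fintype X] [DecidableEq X]

theorem sum_card_image_eq (i : ℕ) (F : Finset X) :
    ∑ T ∈ F.powerset, #{h : Fin i → X | univ.image h = T} = #F ^ i := by
  have hmem (h : Fin i → X) : h ∈ Fintype.piFinset (fun _ : Fin i => F) ↔
      univ.image h ⊆ F := by
    simp [Fintype.mem_piFinset, image_subset_iff]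
  have hpow : #(Fintype.piFinset fun _ : Fin i => F) = #F ^ i := by simp
  rw [← hpow, card_eq_sum_card_fiberwise (f := fun h : Fin i → X => univ.image h)
    (t := F.powerset) fun h hh => mem_coe.2 (mem_powerset.2 ((hmem h).1 hh))]
  refine sum_congr rfl fun T hT => ?_
  congr 1
  ext h
  simp only [mem_filter, mem_univ, true_and, hmem, iff_and_self]
  rintro rfl
  exact mem_powerset.1 hT

theorem sum_stirling1_mul_card_image_eq (k : ℕ) (F : Finset X) :
    ∑ i ∈ range (k + 1), (-1 : ℚ) ^ (k + i) * (stirling1 k i : ℚ) *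
        (#{h : Fin i → X | univ.image h = F} : ℚ) =
      if #F = k then (k.factorial : ℚ) else 0 := by
  refine congrFun (eq_of_sum_powerset_eq (u := fun F => ∑ i ∈ range (k + 1),
    (-1 : ℚ) ^ (k + i) * (stirling1 k i : ℚ) * (#{h : Fin i → X | univ.image h = F} : ℚ))
    (v := fun F => if #F = k then (k.factorial : ℚ) else 0) fun F => ?_) F
  rw [sum_comm]
  simp_rw [← mul_sum, ← Nat.cast_sum, sum_card_image_eq, Nat.cast_pow, sum_stirling1_mul_pow]
  rw [← sum_filter, ← powersetCard_eq_filter, sum_const, card_powersetCard, nsmul_eq_mul,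
    ← Nat.cast_mul, mul_comm, ← Nat.descFactorial_eq_factorial_mul_choose,
    ← descPochhammer_eval_eq_descFactorial, descPochhammer_eval_eq_prod_range]

theorem sum_stirling1_mul_card_image (k : ℕ) (Q : Finset X → Prop) [DecidablePred Q] :
    ∑ i ∈ range (k + 1), (-1 : ℚ) ^ (k + i) * (stirling1 k i : ℚ) *
        (#{h : Fin i → X | Q (univ.image h)} : ℚ) =
      k.factorial * (#{F : Finset X | Q F ∧ #F = k} : ℚ) := by
  have hfib (i : ℕ) : #{h : Fin i → X | Q (univ.image h)} =
      ∑ F : Finset X with Q F, #{h : Fin i → X | univ.image h = F} := by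
    rw [card_eq_sum_card_fiberwise (f := fun h : Fin i → X => univ.image h)
      (t := {F : Finset X | Q F}) (by intro h; simp)]
    refine sum_congr rfl fun F hF => ?_
    rw [mem_filter] at hF
    congr 1
    ext h
    simp only [mem_filter, mem_univ, true_and, and_iff_right_iff_imp]
    rintro rfl
    exact hF.2
  simp_rw [hfib, Nat.cast_sum, mul_sum]
  rw [sum_comm]
  simp_rw [sum_stirling1_mul_card_image_eq]
  rw [← sum_filter, filter_filter, sum_const, nsmul_eq_mul, mul_comm]

end Surjections

section Bipartitions

/-- The partition of a finite type into the nonempty fibres of a function. -/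
def fibrePartition {ι β : Type*} [Fintype ι] [DecidableEq ι] [DecidableEq β] (f : ι → β) :
    Finset (Finset ι) :=
  univ.image fun x => ({y | f y = f x} : Finset ι)

theorem cuts_fibrePartition {ι β : Type*} [Fintype ι] [DecidableEq ι] [DecidableEq β]
    {f : ι → β} {x y : ι} : Cuts (fibrePartition f) x y ↔ f x ≠ f y := by
  constructor
  · rintro ⟨A, hA, B, hB, hAB, hx, hy⟩ hxy
    simp only [fibrePartition, mem_image, mem_univ, true_and] at hA hB
    obtain ⟨a, rfl⟩ := hA
    obtain ⟨b, rfl⟩ := hB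
    simp only [mem_filter, mem_univ, true_and] at hx hy
    exact hAB (by rw [← hx, ← hy, hxy])
  · intro h
    refine ⟨_, mem_image_of_mem _ (mem_univ x), _, mem_image_of_mem _ (mem_univ y), ?_,
      by simp, by simp⟩
    intro h'
    have : x ∈ ({z | f z = f y} : Finset ι) := h' ▸ by simp
    exact h (by simpa using this)

theorem isBipartition_fibrePartition {ι : Type*} [Fintype ι] [DecidableEq ι] (f : ι → Bool) :
    IsBipartition univ (fibrePartition f) := by
  refine ⟨?_, ?_, ?_, ?_⟩
  · have : fibrePartition f =
        (univ.image f).image fun b => ({y | f y = b} : Finset ι) := by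
      rw [image_image]; rfl
    rw [this]
    exact card_image_le.trans ((card_le_univ _).trans (by simp))
  · simp only [fibrePartition, mem_image, mem_univ, true_and, forall_exists_index,
      forall_apply_eq_imp_iff]
    exact fun x => ⟨x, by simp⟩
  · simp only [fibrePartition, mem_image, mem_univ, true_and, forall_exists_index,
      forall_apply_eq_imp_iff]
    intro x y hxy
    rw [disjoint_left]
    intro z hx hy
    simp only [mem_filter, mem_univ, true_and] at hx hy
    exact hxy (by rw [← hx, ← hy])
  · rw [eq_univ_iff_forall]
    intro x
    rw [mem_sup]
    exact ⟨_, mem_image_of_mem _ (mem_univ x), by simp⟩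

theorem IsBipartition.cuts_iff_notMem {S : Finset α} {P : Finset (Finset α)}
    (hP : IsBipartition S P) {A : Finset α} (hA : A ∈ P) {x y : α} (hx : x ∈ A) (hy : y ∈ S) :
    Cuts P x y ↔ y ∉ A := by
  obtain ⟨-, -, hdisj, hsup⟩ := hP
  have huniq {B C : Finset α} {z : α} (hB : B ∈ P) (hC : C ∈ P) (hzB : z ∈ B) (hzC : z ∈ C) :
      B = C := by
    by_contra h
    exact disjoint_left.1 (hdisj B hB C hC h) hzB hzC
  constructor
  · rintro ⟨B, hB, C, hC, hBC, hxB, hyC⟩ hyA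
    exact hBC ((huniq hB hA hxB hx).trans (huniq hA hC hyA hyC))
  · intro hyA
    rw [← hsup, mem_sup] at hy
    obtain ⟨B, hB, hyB⟩ := hy
    exact ⟨A, hA, B, hB, fun h => hyA (h ▸ hyB), hx, hyB⟩

theorem IsBipartition.eq_fibrePartition {ι : Type*} [Fintype ι] [DecidableEq ι]
    {P : Finset (Finset ι)} (hP : IsBipartition univ P) (o : ι) {f : ι → Bool}
    (hf : ∀ y, f y = true ↔ Cuts P o y) : fibrePartition f = P := by
  have hcover (x : ι) : ∃ A ∈ P, x ∈ A := by
    have := mem_univ x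
    rwa [← hP.2.2.2, mem_sup] at this
  obtain ⟨O, hO, hoO⟩ := hcover o
  have hfO (y : ι) : f y = true ↔ y ∉ O :=
    (hf y).trans (hP.cuts_iff_notMem hO hoO (mem_univ y))
  have hdisj := hP.2.2.1
  have hfibre {A : Finset ι} (hA : A ∈ P) {x : ι} (hx : x ∈ A) :
      ({y | f y = f x} : Finset ι) = A := by
    ext y
    simp only [mem_filter, mem_univ, true_and]
    rw [Bool.eq_iff_iff, hfO, hfO, not_iff_not]
    by_cases hAO : A = O
    · subst hAO; simp [hx]
    · have hxO : x ∉ O := disjoint_left.1 (hdisj A hA O hO hAO) hx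
      simp only [hxO, iff_false]
      constructor
      · intro hy
        obtain ⟨B, hB, hyB⟩ := hcover y
        by_contra hyA
        have hBA : B ≠ A := fun h => hyA (h ▸ hyB)
        have hBO : B ≠ O := fun h => hy (h ▸ hyB)
        have hsub : ({B, A, O} : Finset (Finset ι)) ⊆ P := by
          simp [insert_subset_iff, hA, hB, hO]
        have := (card_le_card hsub).trans hP.1
        rw [card_eq_three.2 ⟨B, A, O, hBA, hBO, hAO, rfl⟩] at this
        omega
      · exact fun hy => disjoint_left.1 (hdisj A hA O hO hAO) hy
  ext A
  simp only [fibrePartition, mem_image, mem_univ, true_and]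
  constructor
  · rintro ⟨x, rfl⟩
    obtain ⟨B, hB, hxB⟩ := hcover x
    rwa [hfibre hB hxB]
  · intro hA
    obtain ⟨x, hx⟩ := hP.2.1 A hA
    exact ⟨x, hfibre hA hx⟩

variable {m : ℕ}

theorem fibrePartition_cons_injective :
    Function.Injective fun g : Fin m → Bool =>
      fibrePartition (Fin.cons false g : Fin (m + 1) → Bool) := by
  intro g g' h
  funext x
  have h1 := cuts_fibrePartition (f := (Fin.cons false g : Fin (m + 1) → Bool))
    (x := 0) (y := x.succ)
  have h2 := cuts_fibrePartition (f := (Fin.cons false g' : Fin (m + 1) → Bool))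
    (x := 0) (y := x.succ)
  dsimp only at h
  rw [h, h2, Fin.cons_zero, Fin.cons_zero, Fin.cons_succ, Fin.cons_succ] at h1
  revert h1
  cases g x <;> cases g' x <;> decide

theorem IsBipartition.exists_cons {P : Finset (Finset (Fin (m + 1)))}
    (hP : IsBipartition univ P) :
    ∃ g : Fin m → Bool, fibrePartition (Fin.cons false g : Fin (m + 1) → Bool) = P := by
  classical
  refine ⟨fun x => decide (Cuts P 0 x.succ), hP.eq_fibrePartition 0 fun y => ?_⟩
  refine Fin.cases ?_ (fun x => by simp) y
  rw [Fin.cons_zero]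
  refine iff_of_false Bool.false_ne_true ?_
  rintro ⟨A, hA, B, hB, hAB, h0A, h0B⟩
  exact disjoint_left.1 (hP.2.2.1 A hA B hB hAB) h0A h0B

/-- A set of Boolean vectors, each extended by `false` at `0`, tells all indices apart. -/
def SeparatesIndices (F : Finset (Fin m → Bool)) : Prop :=
  ∀ x y : Fin (m + 1), x ≠ y → ∃ g ∈ F,
    (Fin.cons false g : Fin (m + 1) → Bool) x ≠ (Fin.cons false g : Fin (m + 1) → Bool) y

open Classical in
theorem tauSep_succ (k : ℕ) :
    tauSep (m + 1) k = #{F : Finset (Fin m → Bool) | SeparatesIndices F ∧ #F = k} := by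
  rw [tauSep, ← Set.ncard_coe_finset]
  symm
  refine Set.ncard_congr (fun F _ => F.image fun g : Fin m → Bool =>
      fibrePartition (Fin.cons false g : Fin (m + 1) → Bool)) ?_ ?_ ?_
  · intro F hF
    simp only [coe_filter, mem_univ, true_and, Set.mem_ofPred_eq] at hF
    refine ⟨?_, ?_, ?_⟩
    · simp only [mem_image, forall_exists_index, and_imp, forall_apply_eq_imp_iff₂]
      exact fun g _ => isBipartition_fibrePartition _
    · intro x _ y _ hxy
      obtain ⟨g, hg, hne⟩ := hF.1 x y hxy
      exact ⟨_, mem_image_of_mem _ hg, cuts_fibrePartition.2 hne⟩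
    · rw [card_image_of_injective _ fibrePartition_cons_injective, hF.2]
  · intro F G _ _ h
    exact image_injective fibrePartition_cons_injective h
  · rintro F ⟨hbip, hsep, hcard⟩
    obtain ⟨G, -, rfl⟩ := subset_image_iff.1 (show F ⊆ (univ : Finset (Fin m → Bool)).image
        fun g => fibrePartition (Fin.cons false g : Fin (m + 1) → Bool) from fun P hP => by
          obtain ⟨g, hg⟩ := (hbip P hP).exists_cons
          exact mem_image.2 ⟨g, mem_univ g, hg⟩)
    refine ⟨G, ?_, rfl⟩
    simp only [coe_filter, mem_univ, true_and, Set.mem_ofPred_eq]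
    refine ⟨fun x y hxy => ?_, ?_⟩
    · obtain ⟨P, hP, hcut⟩ := hsep x (mem_univ x) y (mem_univ y) hxy
      obtain ⟨g, hg, rfl⟩ := mem_image.1 hP
      exact ⟨g, hg, cuts_fibrePartition.1 hcut⟩
    · rwa [card_image_of_injective _ fibrePartition_cons_injective] at hcard

theorem separatesIndices_image_iff {i : ℕ} (h : Fin i → Fin m → Bool) :
    SeparatesIndices (univ.image h) ↔
      (∀ x, Function.swap h x ≠ fun _ => false) ∧ Function.Injective (Function.swap h) := by
  have key : SeparatesIndices (univ.image h) ↔ Function.Injective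
      (Fin.cons (fun _ => false) (Function.swap h) : Fin (m + 1) → Fin i → Bool) := by
    have hval (x : Fin (m + 1)) (j : Fin i) :
        (Fin.cons (fun _ => false) (Function.swap h) : Fin (m + 1) → Fin i → Bool) x j =
          (Fin.cons false (h j) : Fin (m + 1) → Bool) x := by
      refine Fin.cases ?_ (fun x => ?_) x <;> simp [Function.swap]
    simp only [SeparatesIndices, mem_image, mem_univ, true_and, exists_exists_eq_and]
    refine forall_congr' fun x => forall_congr' fun y => ?_
    rw [funext_iff, ← not_imp_not (a := x = y)]
    simp only [hval, not_forall, ne_eq]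
  rw [key, Fin.cons_injective_iff, Set.mem_range, not_exists]

open Classical in
theorem card_separatesIndices_image (i : ℕ) :
    #{h : Fin i → Fin m → Bool | SeparatesIndices (univ.image h)} =
      (2 ^ i - 1).descFactorial m := by
  have hcard : Fintype.card (Fin m ↪ {v : Fin i → Bool // v ≠ fun _ => false}) =
      (2 ^ i - 1).descFactorial m := by
    rw [Fintype.card_embedding_eq, Fintype.card_fin, Fintype.card_subtype_compl]
    simp
  rw [← hcard, ← Fintype.card_subtype]
  simp_rw [separatesIndices_image_iff]
  refine Fintype.card_congr
    { toFun := fun h => ⟨fun x => ⟨Function.swap h.1 x, h.2.1 x⟩, fun x y hxy =>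
        h.2.2 (congrArg Subtype.val hxy)⟩
      invFun := fun e => ⟨fun j x => (e x).1 j, fun x => (e x).2, fun x y hxy =>
        e.injective (Subtype.ext hxy)⟩
      left_inv := fun _ => rfl
      right_inv := fun _ => rfl }

end Bipartitions

/-- For `2 ≤ n` and `1 ≤ k ≤ 2 ^ (n - 1)`:
`τ_{n,k} = ((n−1)!/k!) · ∑_{i=1}^{k} (−1)^(k−i) · c(k, i) · C(2^i − 1, n − 1)`. -/
theorem tauSep_eq_sum_stirling1 (n k : ℕ) (hn : 2 ≤ n) (hk1 : 1 ≤ k)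
    (hk2 : k ≤ 2 ^ (n - 1)) :
    (tauSep n k : ℚ) =
      ((n - 1).factorial : ℚ) / (k.factorial : ℚ) *
        ∑ i ∈ Finset.Icc 1 k, (-1 : ℚ) ^ (k - i) * (stirling1 k i : ℚ) *
          (((2 ^ i - 1).choose (n - 1) : ℕ) : ℚ) := by
  classical
  obtain ⟨m, rfl⟩ : ∃ m, n = m + 1 := ⟨n - 1, by omega⟩
  have hsum := sum_stirling1_mul_card_image k (SeparatesIndices (m := m))
  rw [← tauSep_succ] at hsum
  have hk : (k.factorial : ℚ) ≠ 0 := by exact_mod_cast k.factorial_ne_zero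
  rw [div_mul_eq_mul_div, eq_div_iff hk, mul_comm, ← hsum, mul_sum, Nat.add_sub_cancel,
    range_eq_Ico, sum_eq_sum_Ico_succ_bot (Nat.succ_pos k)]
  obtain ⟨l, rfl⟩ : ∃ l, k = l + 1 := ⟨k - 1, by omega⟩
  rw [show stirling1 (l + 1) 0 = 0 by simp [stirling1], Nat.cast_zero, mul_zero, zero_mul,
    zero_add]
  refine sum_congr rfl fun i hi => ?_
  rw [card_separatesIndices_image, Nat.descFactorial_eq_factorial_mul_choose, Nat.cast_mul]
  have hi' : i ≤ l + 1 := by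
    have := (mem_Ico.1 hi).2
    omega
  have hsign : (-1 : ℚ) ^ (l + 1 + i) = (-1) ^ (l + 1 - i) := by
    rw [show l + 1 + i = l + 1 - i + 2 * i by omega, pow_add, pow_mul]
    simp
  rw [hsign]
  ring
end

section
/- For every n ≥ 2, the number of separating families of minimum size ⌈log₂ n⌉ for an n-element set equals ((n−1)! / ⌈log₂ n⌉!) · C(2^⌈log₂ n⌉ − 1, n − 1), where C(·,·) is the binomial coefficient. -/
open Finset

variable {α : Type*} [DecidableEq α]

/-- The partition of `V` into the nonempty level sets of `f`. -/
def levelSets {V : Type*} [Fintype V] [DecidableEq V] (f : V → Bool) : Finset (Finset V) :=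
  univ.image fun x => univ.filter fun y => f y = f x

section

variable {V : Type*} [Fintype V] [DecidableEq V]

lemma cuts_levelSets {f : V → Bool} {x y : V} : Cuts (levelSets f) x y ↔ f x ≠ f y := by
  constructor
  · rintro ⟨A, hA, B, hB, hAB, hx, hy⟩ h
    simp only [levelSets, mem_image, mem_univ, true_and] at hA hB
    obtain ⟨a, rfl⟩ := hA
    obtain ⟨b, rfl⟩ := hB
    simp only [mem_filter, mem_univ, true_and] at hx hy
    exact hAB (by rw [← hx, ← hy, h])
  · intro h
    refine ⟨univ.filter fun z => f z = f x, by simp [levelSets],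
      univ.filter fun z => f z = f y, by simp [levelSets], fun he => h ?_, by simp, by simp⟩
    have : x ∈ univ.filter fun z => f z = f y := he ▸ by simp
    simpa using this

lemma isBipartition_levelSets (f : V → Bool) : IsBipartition univ (levelSets f) := by
  refine ⟨?_, ?_, ?_, ?_⟩
  · have : levelSets f = (univ.image f).image fun b => univ.filter fun y => f y = b := by
      simp only [levelSets, image_image, Function.comp_def]
    rw [this]
    exact card_image_le.trans ((card_le_univ _).trans (by simp))
  · simp only [levelSets, mem_image, mem_univ, true_and]
    rintro _ ⟨x, rfl⟩
    exact ⟨x, by simp⟩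
  · simp only [levelSets, mem_image, mem_univ, true_and]
    rintro _ ⟨x, rfl⟩ _ ⟨y, rfl⟩ h
    rw [disjoint_left]
    intro z hx hy
    simp only [mem_filter, mem_univ, true_and] at hx hy
    exact h (by rw [← hx, ← hy])
  · rw [eq_univ_iff_forall]
    intro x
    rw [mem_sup]
    exact ⟨univ.filter fun z => f z = f x, by simp [levelSets], by simp⟩

lemma eq_of_levelSets_eq {f g : V → Bool} {r : V} (hr : f r = g r)
    (h : levelSets f = levelSets g) : f = g := by
  funext x
  have hc : f x ≠ f r ↔ g x ≠ g r := by rw [← cuts_levelSets, h, cuts_levelSets]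
  rw [← hr] at hc
  revert hc
  cases f x <;> cases g x <;> cases f r <;> simp

lemma exists_levelSets_eq {P : Finset (Finset V)} (hP : IsBipartition univ P) (r : V) :
    ∃ f : V → Bool, f r = false ∧ levelSets f = P := by
  obtain ⟨hcard, hne, hdisj, hsup⟩ := hP
  have hcover (x : V) : ∃ A ∈ P, x ∈ A := by
    have : x ∈ P.sup id := hsup ▸ mem_univ x
    simpa [mem_sup] using this
  have hunique {A B : Finset V} (hA : A ∈ P) (hB : B ∈ P) {x : V} (hxA : x ∈ A)
      (hxB : x ∈ B) : A = B := by
    by_contra h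
    exact disjoint_left.1 (hdisj A hA B hB h) hxA hxB
  obtain ⟨A, hA, hrA⟩ := hcover r
  have key {B : Finset V} (hB : B ∈ P) {x : V} (hx : x ∈ B) :
      (univ.filter fun y => decide (y ∉ A) = decide (x ∉ A)) = B := by
    ext y
    simp only [mem_filter, mem_univ, true_and, decide_eq_decide, not_iff_not]
    constructor
    · intro hy
      obtain ⟨C, hC, hyC⟩ := hcover y
      by_contra hyB
      have hCB : C ≠ B := by
        rintro rfl
        exact hyB hyC
      have hAB : A ≠ B := by
        rintro rfl
        exact hyB (hy.2 hx)
      have hAC : A ≠ C := by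
        rintro rfl
        exact hAB (hunique hA hB (hy.1 hyC) hx)
      have h3 : ({A, B, C} : Finset (Finset V)).card = 3 := card_eq_three.2
        ⟨A, B, C, hAB, hAC, hCB.symm, rfl⟩
      have hsub : ({A, B, C} : Finset (Finset V)) ⊆ P := by
        simp [insert_subset_iff, hA, hB, hC]
      have := card_le_card hsub
      omega
    · intro hy
      constructor
      · intro h
        rwa [hunique hA hB h hy]
      · intro h
        rwa [hunique hA hB h hx]
  refine ⟨fun y => decide (y ∉ A), by simpa using hrA, ?_⟩
  ext C
  simp only [levelSets, mem_image, mem_univ, true_and]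
  constructor
  · rintro ⟨x, rfl⟩
    obtain ⟨B, hB, hx⟩ := hcover x
    rwa [key hB hx]
  · intro hC
    obtain ⟨x, hx⟩ := hne C hC
    exact ⟨x, key hC hx⟩

end

lemma card_filter_image_eq_s10 {X : Type*} [Fintype X] [DecidableEq X] {k : ℕ} {H : Finset X}
    (hH : H.card = k) :
    (univ.filter fun e : Fin k → X => univ.image e = H).card = k.factorial := by
  have hc : (univ : Finset (Fin k ↪ H)).card = k.factorial := by
    rw [card_univ, Fintype.card_embedding_eq]
    simp [hH, Nat.descFactorial_self]
  rw [← hc]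
  symm
  refine card_bij (fun e _ i => (e i : X)) ?_ ?_ ?_
  · intro e _
    simp only [mem_filter, mem_univ, true_and]
    refine eq_of_subset_of_card_le ?_ ?_
    · intro x
      simp only [mem_image, mem_univ, true_and]
      rintro ⟨i, rfl⟩
      exact (e i).2
    · have := card_image_of_injective univ (Subtype.val_injective.comp e.injective)
      simp only [Function.comp_def, card_univ, Fintype.card_fin] at this
      rw [this, hH]
  · intro e _ e' _ h
    ext i
    exact congrFun h i
  · intro e he
    simp only [mem_filter, mem_univ, true_and] at he
    have hinj : Function.Injective e := by
      rw [← Set.injOn_univ, ← coe_univ, ← card_image_iff, he, hH]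
      simp
    refine ⟨⟨fun i => ⟨e i, he ▸ mem_image_of_mem e (mem_univ i)⟩, ?_⟩, mem_univ _, rfl⟩
    intro i j h
    exact hinj (congrArg Subtype.val h)

/-- Ordering the members of each `k`-element set of a family multiplies the count by `k!`. -/
lemma card_filter_image_mem {X : Type*} [Fintype X] [DecidableEq X] {k : ℕ}
    {𝓗 : Finset (Finset X)} (h𝓗 : ∀ H ∈ 𝓗, H.card = k) :
    (univ.filter fun e : Fin k → X => univ.image e ∈ 𝓗).card = 𝓗.card * k.factorial := by
  rw [card_eq_sum_card_fiberwise (f := fun e : Fin k → X => univ.image e) (t := 𝓗)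
    (fun e he => by simpa using he)]
  refine sum_const_nat fun H hH => ?_
  rw [← card_filter_image_eq_s10 (h𝓗 H hH), filter_filter]
  congr 1
  ext e
  simp only [mem_filter, mem_univ, true_and, and_iff_right_iff_imp]
  rintro rfl
  exact hH

/-- A family of bipartitions cutting all pairs of points has at least `⌈log₂ |V|⌉` members. -/
lemma clog_card_le_of_isSeparating {V : Type*} [Fintype V] [DecidableEq V] [Nonempty V]
    {F : Finset (Finset (Finset V))} (hF : ∀ P ∈ F, IsBipartition univ P)
    (hsep : IsSeparating univ F) : Nat.clog 2 (Fintype.card V) ≤ F.card := by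
  obtain ⟨r⟩ := ‹Nonempty V›
  choose f _ hf using fun P : F => exists_levelSets_eq (hF P P.2) r
  refine Nat.clog_le_of_le_pow ?_
  have hinj : Function.Injective fun (x : V) (P : F) => f P x := by
    intro x y h
    by_contra hxy
    obtain ⟨P, hP, hcut⟩ := hsep x (mem_univ x) y (mem_univ y) hxy
    exact cuts_levelSets.1 ((hf ⟨P, hP⟩).symm ▸ hcut) (congrFun h ⟨P, hP⟩)
  simpa using Fintype.card_le_of_injective _ hinj

lemma card_nonzero_embedding (m k : ℕ) :
    Fintype.card (Fin m ↪ {v : Fin k → Bool // v ≠ fun _ => false}) =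
      (2 ^ k - 1).descFactorial m := by
  rw [Fintype.card_embedding_eq]
  simp [Fintype.card_subtype_compl]

lemma tauSep_mul_factorial (m : ℕ) :
    tauSep (m + 1) (Nat.clog 2 (m + 1)) * (Nat.clog 2 (m + 1)).factorial =
      (2 ^ Nat.clog 2 (m + 1) - 1).descFactorial m := by
  classical
  set k := Nat.clog 2 (m + 1)
  have htau : tauSep (m + 1) k =
      (univ.filter fun F : Finset (Finset (Finset (Fin (m + 1)))) =>
        (∀ P ∈ F, IsBipartition univ P) ∧ IsSeparating univ F ∧ F.card = k).card := by
    rw [tauSep, ← Set.ncard_coe_finset]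
    congr 1
    ext F
    simp
  rw [htau, ← card_filter_image_mem (k := k) (by simp), ← card_nonzero_embedding m k, ← card_univ]
  symm
  let ext0 (t : Fin m ↪ {v : Fin k → Bool // v ≠ fun _ => false}) : Fin (m + 1) → Fin k → Bool :=
    Fin.cons (fun _ => false) fun j => (t j : Fin k → Bool)
  refine card_bij (fun t _ i => levelSets fun x => ext0 t x i) ?_ ?_ ?_
  · intro t _
    have hinj : Function.Injective (ext0 t) := by
      rw [Fin.cons_injective_iff]
      refine ⟨?_, Subtype.val_injective.comp t.injective⟩
      rintro ⟨j, hj⟩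
      exact (t j).2 hj
    have hbip : ∀ P ∈ univ.image (fun i => levelSets fun x => ext0 t x i),
        IsBipartition univ P := by
      simp only [mem_image, mem_univ, true_and]
      rintro _ ⟨i, rfl⟩
      exact isBipartition_levelSets _
    have hsep : IsSeparating univ (univ.image (fun i => levelSets fun x => ext0 t x i)) := by
      intro x _ y _ hxy
      obtain ⟨i, hi⟩ := Function.ne_iff.1 (hinj.ne hxy)
      exact ⟨_, mem_image_of_mem _ (mem_univ i), cuts_levelSets.2 hi⟩
    simp only [mem_filter, mem_univ, true_and]
    refine ⟨hbip, hsep, le_antisymm (card_image_le.trans (by simp)) ?_⟩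
    simpa using clog_card_le_of_isSeparating hbip hsep
  · intro t _ t' _ h
    ext j i
    have := eq_of_levelSets_eq (r := 0) (by simp [ext0]) (congrFun h i)
    simpa [ext0] using congrFun this j.succ
  · intro e he
    simp only [mem_filter, mem_univ, true_and] at he
    obtain ⟨hbip, hsep, -⟩ := he
    choose f hf0 hf using fun i =>
      exists_levelSets_eq (hbip (e i) (mem_image_of_mem e (mem_univ i))) 0
    have hinj : Function.Injective fun x i => f i x := by
      intro x y h
      by_contra hxy
      obtain ⟨P, hP, hcut⟩ := hsep x (mem_univ x) y (mem_univ y) hxy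
      obtain ⟨i, -, rfl⟩ := mem_image.1 hP
      rw [← hf i, cuts_levelSets] at hcut
      exact hcut (congrFun h i)
    refine ⟨⟨fun j => ⟨fun i => f i j.succ, fun h => ?_⟩, fun a b h => ?_⟩, mem_univ _, ?_⟩
    · refine Fin.succ_ne_zero j (hinj ?_)
      funext i
      exact (congrFun h i).trans (hf0 i).symm
    · exact Fin.succ_injective _ (hinj (congrArg Subtype.val h))
    · funext i
      rw [← hf i]
      congr 1
      funext x
      refine Fin.cases ?_ (fun j => ?_) x
      · simp [ext0, hf0]
      · simp only [ext0, Fin.cons_succ]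
        rfl

/-- The number of separating families of minimum size `⌈log₂ n⌉` for an `n`-element set
equals `((n−1)! / ⌈log₂ n⌉!) · C(2^⌈log₂ n⌉ − 1, n − 1)`. -/
theorem card_separating_minSize (n : ℕ) (hn : 2 ≤ n) :
    (tauSep n (Nat.clog 2 n) : ℚ) =
      ((n - 1).factorial : ℚ) / ((Nat.clog 2 n).factorial : ℚ) *
        (((2 ^ Nat.clog 2 n - 1).choose (n - 1) : ℕ) : ℚ) := by
  obtain ⟨m, rfl⟩ : ∃ m, n = m + 1 := ⟨n - 1, by omega⟩
  have h := tauSep_mul_factorial m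
  rw [Nat.descFactorial_eq_factorial_mul_choose] at h
  have hk : ((Nat.clog 2 (m + 1)).factorial : ℚ) ≠ 0 := by positivity
  rw [Nat.add_sub_cancel, div_mul_eq_mul_div, eq_div_iff hk]
  exact_mod_cast h
end

section
/- For all n, k with 2 ≤ n and 2 ≤ k ≤ 2^(n−1), the equation σ_{n,k−1} · (k−1)! = σ_{k,n−1} · (n−1)! holds. -/
open Finset

variable {α : Type*} [DecidableEq α]

/-- `sigmaSep n k` is the number of separating families consisting of `k` proper
bipartitions (bipartitions with exactly two components) of an `n`-element set. -/
noncomputable def sigmaSep (n k : ℕ) : ℕ :=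
  Set.ncard {F : Finset (Finset (Finset (Fin n))) |
    (∀ P ∈ F, IsBipartition Finset.univ P ∧ P.card = 2) ∧
      IsSeparating Finset.univ F ∧ F.card = k}

/-- Enumerating the members of the `l`-element finsets satisfying `p` in all possible orders. -/
theorem ncard_finset_mul_factorial {β : Type*} [Fintype β] [DecidableEq β]
    (p : Finset β → Prop) (l : ℕ) :
    {G : Finset β | p G ∧ G.card = l}.ncard * l.factorial =
      {f : Fin l → β | Function.Injective f ∧ p (Finset.univ.image f)}.ncard := by
  classical
  rw [Set.ncard_eq_toFinset_card', Set.ncard_eq_toFinset_card',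
    Finset.card_eq_sum_card_fiberwise (f := fun f : Fin l → β => Finset.univ.image f)
      (t := {G : Finset β | p G ∧ G.card = l}.toFinset)]
  · rw [Finset.sum_const_nat]
    intro G hG
    simp only [Set.mem_toFinset, Set.mem_ofPred_eq] at hG
    obtain ⟨hp, hc⟩ := hG
    have e : Fin l ≃ G := (Fintype.equivFinOfCardEq (by simpa using hc)).symm
    have h := Fintype.card_equiv e
    rw [Fintype.card_fin] at h
    rw [← h, ← Finset.card_univ]
    symm
    refine Finset.card_bij (fun g _ i => (g i : β)) ?_ ?_ ?_
    · intro g _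
      have himg : Finset.univ.image (fun i => (g i : β)) = G := by
        ext b
        simp only [Finset.mem_image, Finset.mem_univ, true_and]
        constructor
        · rintro ⟨i, rfl⟩
          exact (g i).2
        · intro hb
          exact ⟨g.symm ⟨b, hb⟩, by simp⟩
      simp only [Finset.mem_filter, Set.mem_toFinset, Set.mem_ofPred_eq, himg]
      exact ⟨⟨Subtype.val_injective.comp g.injective, hp⟩, trivial⟩
    · intro g _ g' _ h
      ext i
      exact congrFun h i
    · intro f hf
      simp only [Finset.mem_filter, Set.mem_toFinset, Set.mem_ofPred_eq] at hf
      obtain ⟨⟨hinj, -⟩, himg⟩ := hf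
      have hmem : ∀ i, f i ∈ G := fun i => himg ▸ Finset.mem_image_of_mem f (Finset.mem_univ i)
      refine ⟨Equiv.ofBijective (fun i => (⟨f i, hmem i⟩ : G)) ⟨?_, ?_⟩, Finset.mem_univ _, rfl⟩
      · intro i j hij
        exact hinj (Subtype.ext_iff.mp hij)
      · rintro ⟨b, hb⟩
        rw [← himg] at hb
        obtain ⟨i, -, hi⟩ := Finset.mem_image.mp hb
        exact ⟨i, Subtype.ext hi⟩
  · intro f hf
    simp only [Set.coe_toFinset, Set.mem_ofPred_eq] at hf ⊢
    exact ⟨hf.2, by rw [Finset.card_image_of_injective _ hf.1, Finset.card_univ, Fintype.card_fin]⟩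

/-- The two-coloring of `Fin (m + 1)` extending `c` and giving `0` the color `false`. -/
def pointedColoring {m : ℕ} (c : Fin m → Bool) : Fin (m + 1) → Bool :=
  Fin.cons false c

/-- The collection of color classes of a two-coloring. -/
def colorClasses {n : ℕ} (f : Fin n → Bool) : Finset (Finset (Fin n)) :=
  {Finset.univ.filter (fun x => f x = false), Finset.univ.filter (fun x => f x = true)}

theorem colorClasses_ne {n : ℕ} (f : Fin (n + 1) → Bool) :
    Finset.univ.filter (fun x => f x = false) ≠ Finset.univ.filter (fun x => f x = true) := by
  intro h
  have := Finset.ext_iff.mp h 0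
  cases h0 : f 0 <;> simp [h0] at this

theorem cuts_colorClasses {n : ℕ} (f : Fin (n + 1) → Bool) (x y : Fin (n + 1)) :
    Cuts (colorClasses f) x y ↔ f x ≠ f y := by
  have hne := colorClasses_ne f
  constructor
  · rintro ⟨A, hA, B, hB, hAB, hx, hy⟩
    simp only [colorClasses, Finset.mem_insert, Finset.mem_singleton] at hA hB
    rcases hA with rfl | rfl <;> rcases hB with rfl | rfl <;> simp_all
  · intro h
    cases hx : f x <;> cases hy : f y
    · simp [hx, hy] at h
    · exact ⟨_, Finset.mem_insert_self _ _, _, Finset.mem_insert_of_mem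
        (Finset.mem_singleton_self _), hne, by simpa using hx, by simpa using hy⟩
    · exact ⟨_, Finset.mem_insert_of_mem (Finset.mem_singleton_self _), _,
        Finset.mem_insert_self _ _, hne.symm, by simpa using hx, by simpa using hy⟩
    · simp [hx, hy] at h

theorem colorClasses_pointedColoring_injective (m : ℕ) :
    Function.Injective (fun c : Fin m → Bool => colorClasses (pointedColoring c)) := by
  intro c d h
  funext i
  have h1 := cuts_colorClasses (pointedColoring c) 0 i.succ
  have h2 := cuts_colorClasses (pointedColoring d) 0 i.succ
  dsimp only at h
  rw [h, h2] at h1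
  simp only [pointedColoring, Fin.cons_zero, Fin.cons_succ] at h1
  cases hc : c i <;> cases hd : d i <;> simp_all

theorem isBipartition_colorClasses_pointedColoring {m : ℕ} (c : Fin m → Bool)
    (hc : ∃ i, c i = true) :
    IsBipartition Finset.univ (colorClasses (pointedColoring c)) ∧
      (colorClasses (pointedColoring c)).card = 2 := by
  have hcard : (colorClasses (pointedColoring c)).card = 2 :=
    Finset.card_pair (colorClasses_ne _)
  refine ⟨⟨hcard.le, ?_, ?_, ?_⟩, hcard⟩
  · intro A hA
    simp only [colorClasses, Finset.mem_insert, Finset.mem_singleton] at hA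
    rcases hA with rfl | rfl
    · exact ⟨0, Finset.mem_filter.mpr ⟨Finset.mem_univ _, by simp [pointedColoring]⟩⟩
    · obtain ⟨i, hi⟩ := hc
      exact ⟨i.succ, Finset.mem_filter.mpr
        ⟨Finset.mem_univ _, by simp [pointedColoring, hi]⟩⟩
  · intro A hA B hB hAB
    simp only [colorClasses, Finset.mem_insert, Finset.mem_singleton] at hA hB
    rw [Finset.disjoint_left]
    rcases hA with rfl | rfl <;> rcases hB with rfl | rfl <;> simp_all
  · ext x
    cases hx : pointedColoring c x <;> simp [colorClasses, hx]

theorem IsBipartition.exists_colorClasses {m : ℕ} {P : Finset (Finset (Fin (m + 1)))}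
    (hP : IsBipartition Finset.univ P) (hcard : P.card = 2) :
    ∃ c : Fin m → Bool, (∃ i, c i = true) ∧ colorClasses (pointedColoring c) = P := by
  obtain ⟨A, B, hAB, h0, rfl⟩ :
      ∃ A B : Finset (Fin (m + 1)), A ≠ B ∧ (0 : Fin (m + 1)) ∈ A ∧ P = {A, B} := by
    obtain ⟨A, B, hAB, rfl⟩ := Finset.card_eq_two.mp hcard
    have h0 : (0 : Fin (m + 1)) ∈ ({A, B} : Finset (Finset (Fin (m + 1)))).sup id := by
      rw [hP.2.2.2]
      exact Finset.mem_univ _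
    simp only [Finset.sup_insert, Finset.sup_singleton, id_eq, Finset.sup_eq_union,
      Finset.mem_union] at h0
    rcases h0 with h0 | h0
    · exact ⟨A, B, hAB, h0, rfl⟩
    · exact ⟨B, A, hAB.symm, h0, Finset.pair_comm _ _⟩
  obtain ⟨-, hne, hdis, hsup⟩ := hP
  have hd : Disjoint A B := hdis A (by simp) B (by simp) hAB
  have hmem : ∀ x, x ∈ A ↔ x ∉ B := by
    intro x
    refine ⟨fun h => Finset.disjoint_left.mp hd h, fun h => ?_⟩
    have hx := Finset.mem_univ x
    rw [← hsup] at hx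
    simp only [Finset.sup_insert, Finset.sup_singleton, id_eq, Finset.sup_eq_union,
      Finset.mem_union] at hx
    exact hx.resolve_right h
  have hcol : ∀ x, pointedColoring (fun i : Fin m => decide (i.succ ∈ B)) x = decide (x ∈ B) := by
    intro x
    refine Fin.cases ?_ (fun i => ?_) x
    · simpa [pointedColoring] using (hmem 0).mp h0
    · simp [pointedColoring]
  refine ⟨fun i => decide (i.succ ∈ B), ?_, ?_⟩
  · obtain ⟨x, hx⟩ := hne B (by simp)
    have hx0 : x ≠ 0 := by
      rintro rfl
      exact (hmem 0).mp h0 hx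
    obtain ⟨i, rfl⟩ := Fin.exists_succ_eq.mpr hx0
    exact ⟨i, by simpa using hx⟩
  · unfold colorClasses
    congr 1
    · ext x
      simp [hcol, hmem]
    · congr 1
      ext x
      simp [hcol]

/-- Boolean matrices with distinct nonzero rows and distinct nonzero columns. -/
def reducedMatrices (l m : ℕ) : Set (Fin l → Fin m → Bool) :=
  {M | (Function.Injective M ∧ ∀ i, ∃ j, M i j = true) ∧
    (Function.Injective (fun j i => M i j) ∧ ∀ j, ∃ i, M i j = true)}

theorem ncard_reducedMatrices_comm (l m : ℕ) :
    (reducedMatrices l m).ncard = (reducedMatrices m l).ncard := by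
  refine Set.ncard_congr (fun M _ j i => M i j) ?_ ?_ ?_
  · rintro M ⟨h1, h2⟩
    exact ⟨h2, h1⟩
  · intro M N _ _ h
    funext i j
    exact congrFun (congrFun h j) i
  · rintro M ⟨h1, h2⟩
    exact ⟨fun i j => M j i, ⟨h2, h1⟩, rfl⟩

theorem forall_exists_pointedColoring_ne_iff {l m : ℕ} (M : Fin l → Fin m → Bool) :
    (∀ x y : Fin (m + 1), x ≠ y → ∃ i, pointedColoring (M i) x ≠ pointedColoring (M i) y) ↔
      Function.Injective (fun j i => M i j) ∧ ∀ j, ∃ i, M i j = true := by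
  constructor
  · intro h
    refine ⟨fun j k hjk => ?_, fun j => ?_⟩
    · by_contra hne
      obtain ⟨i, hi⟩ := h j.succ k.succ (fun h => hne (Fin.succ_injective _ h))
      exact hi (by simpa [pointedColoring] using congrFun hjk i)
    · obtain ⟨i, hi⟩ := h j.succ 0 (Fin.succ_ne_zero j)
      exact ⟨i, by simpa [pointedColoring] using hi⟩
  · rintro ⟨hinj, hpos⟩ x y
    refine Fin.cases ?_ (fun j => ?_) x <;> refine Fin.cases ?_ (fun k => ?_) y
    · exact fun h => absurd rfl h
    · intro _
      obtain ⟨i, hi⟩ := hpos k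
      exact ⟨i, by simp [pointedColoring, hi]⟩
    · intro _
      obtain ⟨i, hi⟩ := hpos j
      exact ⟨i, by simp [pointedColoring, hi]⟩
    · intro hne
      by_contra! h
      refine hne (congrArg Fin.succ (hinj (funext fun i => ?_)))
      simpa [pointedColoring] using h i

theorem sigmaSep_succ_mul_factorial (m l : ℕ) :
    sigmaSep (m + 1) l * l.factorial = (reducedMatrices l m).ncard := by
  have h := ncard_finset_mul_factorial
    (fun F : Finset (Finset (Finset (Fin (m + 1)))) =>
      (∀ P ∈ F, IsBipartition Finset.univ P ∧ P.card = 2) ∧ IsSeparating Finset.univ F) l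
  simp only [and_assoc] at h
  simp only [sigmaSep]
  rw [h]
  symm
  refine Set.ncard_congr (fun M _ i => colorClasses (pointedColoring (M i))) ?_ ?_ ?_
  · rintro M ⟨⟨hinj, hpos⟩, hcol⟩
    refine ⟨(colorClasses_pointedColoring_injective m).comp hinj, ?_, ?_⟩
    · simp only [Finset.mem_image, Finset.mem_univ, true_and, forall_exists_index,
        forall_apply_eq_imp_iff]
      exact fun i => isBipartition_colorClasses_pointedColoring _ (hpos i)
    · intro x _ y _ hxy
      obtain ⟨i, hi⟩ := (forall_exists_pointedColoring_ne_iff M).mpr hcol x y hxy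
      exact ⟨_, Finset.mem_image_of_mem _ (Finset.mem_univ i), (cuts_colorClasses _ _ _).mpr hi⟩
  · intro M N _ _ h
    funext i
    exact colorClasses_pointedColoring_injective m (congrFun h i)
  · rintro f ⟨hinj, hbip, hsep⟩
    have hf : ∀ i, ∃ c : Fin m → Bool,
        (∃ j, c j = true) ∧ colorClasses (pointedColoring c) = f i := fun i =>
      have hi := hbip (f i) (Finset.mem_image_of_mem f (Finset.mem_univ i))
      hi.1.exists_colorClasses hi.2
    choose M hpos hM using hf
    refine ⟨M, ⟨⟨?_, hpos⟩, (forall_exists_pointedColoring_ne_iff M).mp ?_⟩, funext hM⟩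
    · intro i j hij
      apply hinj
      rw [← hM, ← hM, hij]
    · intro x y hxy
      obtain ⟨P, hP, hcut⟩ := hsep x (Finset.mem_univ _) y (Finset.mem_univ _) hxy
      obtain ⟨i, -, rfl⟩ := Finset.mem_image.mp hP
      rw [← hM] at hcut
      exact ⟨i, (cuts_colorClasses _ _ _).mp hcut⟩

/-- For `2 ≤ n` and `2 ≤ k ≤ 2 ^ (n - 1)`:
`σ_{n,k−1} · (k−1)! = σ_{k,n−1} · (n−1)!`. -/
theorem sigmaSep_transpose (n k : ℕ) (hn : 2 ≤ n) (hk1 : 2 ≤ k)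
    (hk2 : k ≤ 2 ^ (n - 1)) :
    sigmaSep n (k - 1) * (k - 1).factorial = sigmaSep k (n - 1) * (n - 1).factorial := by
  obtain ⟨m, rfl⟩ : ∃ m, n = m + 1 := ⟨n - 1, by omega⟩
  obtain ⟨l, rfl⟩ : ∃ l, k = l + 1 := ⟨k - 1, by omega⟩
  simp only [Nat.add_sub_cancel]
  rw [sigmaSep_succ_mul_factorial, sigmaSep_succ_mul_factorial, ncard_reducedMatrices_comm]
end

section
/- For every k ≥ 1, the minimum size n of a finite set admitting a separating family of k arbitrary bipartitions is ⌈log₂ k⌉ + 1; that is, if a set of n elements admits a separating family of k bipartitions then n ≥ ⌈log₂ k⌉ + 1, and a set of ⌈log₂ k⌉ + 1 elements admits such a family. -/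
open Finset

variable {α : Type*} [DecidableEq α]

/-- The bipartition of `S` into `A` and its complement, empty parts being dropped. -/
def splitBy (S A : Finset α) : Finset (Finset α) := ({A, S \ A} : Finset (Finset α)).erase ∅

theorem mem_splitBy {S A B : Finset α} : B ∈ splitBy S A ↔ B ≠ ∅ ∧ (B = A ∨ B = S \ A) := by
  simp [splitBy]

theorem isBipartition_splitBy {S A : Finset α} (h : A ⊆ S) : IsBipartition S (splitBy S A) := by
  refine ⟨(card_le_card (erase_subset _ _)).trans card_le_two, ?_, ?_, ?_⟩
  · intro B hB
    exact nonempty_iff_ne_empty.2 (mem_splitBy.1 hB).1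
  · intro B hB C hC hBC
    rcases (mem_splitBy.1 hB).2 with rfl | rfl <;> rcases (mem_splitBy.1 hC).2 with rfl | rfl
    · exact absurd rfl hBC
    · exact disjoint_sdiff
    · exact sdiff_disjoint
    · exact absurd rfl hBC
  · ext x
    simp only [mem_sup, mem_splitBy, id]
    constructor
    · rintro ⟨B, ⟨-, rfl | rfl⟩, hx⟩
      · exact h hx
      · exact (mem_sdiff.1 hx).1
    · intro hx
      by_cases hA : x ∈ A
      · exact ⟨A, ⟨ne_empty_of_mem hA, Or.inl rfl⟩, hA⟩
      · have hx' : x ∈ S \ A := mem_sdiff.2 ⟨hx, hA⟩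
        exact ⟨S \ A, ⟨ne_empty_of_mem hx', Or.inr rfl⟩, hx'⟩

theorem cuts_splitBy {S A : Finset α} {x y : α} (hx : x ∈ A) (hy : y ∈ S \ A) :
    Cuts (splitBy S A) x y := by
  refine ⟨A, mem_splitBy.2 ⟨ne_empty_of_mem hx, Or.inl rfl⟩, S \ A,
    mem_splitBy.2 ⟨ne_empty_of_mem hy, Or.inr rfl⟩, ?_, hx, hy⟩
  intro h
  rw [h] at hx
  exact (mem_sdiff.1 hx).2 (h ▸ hx)

theorem Cuts.symm {P : Finset (Finset α)} {x y : α} (h : Cuts P x y) : Cuts P y x := by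
  obtain ⟨A, hA, B, hB, hAB, hx, hy⟩ := h
  exact ⟨B, hB, A, hA, hAB.symm, hy, hx⟩

theorem splitBy_injOn {S : Finset α} {r : α} (hr : r ∈ S) :
    Set.InjOn (splitBy S) ((S.erase r).powerset : Set (Finset α)) := by
  have key : ∀ A ⊆ S.erase r, ∀ B ⊆ S.erase r, splitBy S A = splitBy S B → A ⊆ B := by
    intro A hA B hB h x hx
    have hAm : A ∈ splitBy S B := h ▸ mem_splitBy.2 ⟨ne_empty_of_mem hx, Or.inl rfl⟩
    rcases (mem_splitBy.1 hAm).2 with rfl | hAB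
    · exact hx
    · have hrA : r ∈ A := by
        rw [hAB]
        exact mem_sdiff.2 ⟨hr, fun hrB => notMem_erase r S (hB hrB)⟩
      exact absurd (hA hrA) (notMem_erase r S)
  intro A hA B hB h
  have hA' := mem_powerset.1 (mem_coe.1 hA)
  have hB' := mem_powerset.1 (mem_coe.1 hB)
  exact (key A hA' B hB' h).antisymm (key B hB' A hA' h.symm)

theorem IsBipartition.exists_eq_splitBy {S : Finset α} {r : α} (hr : r ∈ S)
    {P : Finset (Finset α)} (hP : IsBipartition S P) : ∃ A ⊆ S.erase r, splitBy S A = P := by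
  obtain ⟨hcard, hne, hdisj, hsup⟩ := hP
  have hr' := hr
  rw [← hsup, mem_sup] at hr'
  obtain ⟨R, hR, hrR⟩ := hr'
  have hle : (P.erase R).card ≤ 1 := by
    rw [card_erase_of_mem hR]
    omega
  rcases (P.erase R).eq_empty_or_nonempty with h0 | ⟨B, hB⟩
  · have hPR : P = {R} := by rw [← insert_erase hR, h0]; rfl
    have hSR : R = S := by simpa [hPR] using hsup
    subst hSR
    refine ⟨∅, empty_subset _, ?_⟩
    ext C
    rw [mem_splitBy, hPR, mem_singleton, sdiff_empty]
    have := ne_empty_of_mem hrR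
    constructor
    · rintro ⟨h, h' | h'⟩
      · exact absurd h' h
      · exact h'
    · rintro rfl
      exact ⟨this, Or.inr rfl⟩
  · have hPRB : P = {R, B} := by
      rw [← insert_erase hR]
      congr 1
      exact eq_singleton_iff_unique_mem.2 ⟨hB, fun C hC => card_le_one.1 hle C hC B hB⟩
    obtain ⟨hBR, hBP⟩ := mem_erase.1 hB
    have hd : Disjoint R B := hdisj R hR B hBP hBR.symm
    have hS : R ∪ B = S := by simpa [hPRB] using hsup
    have hSB : S \ B = R := by rw [← hS, union_sdiff_right, sdiff_eq_self_of_disjoint hd]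
    refine ⟨B, ?_, ?_⟩
    · intro x hx
      refine mem_erase.2 ⟨?_, hS ▸ mem_union_right R hx⟩
      rintro rfl
      exact disjoint_left.1 hd hrR hx
    · rw [splitBy, hSB, hPRB, pair_comm, erase_eq_of_notMem]
      rw [← hPRB]
      exact fun h => not_nonempty_empty (hne ∅ h)

/-- All bipartitions of `S`, each listed by its part avoiding the base point `r`. -/
def bipartitions (S : Finset α) (r : α) : Finset (Finset (Finset α)) :=
  (S.erase r).powerset.image (splitBy S)

theorem mem_bipartitions {S : Finset α} {r : α} (hr : r ∈ S) {P : Finset (Finset α)} :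
    P ∈ bipartitions S r ↔ IsBipartition S P := by
  simp only [bipartitions, mem_image, mem_powerset]
  constructor
  · rintro ⟨A, hA, rfl⟩
    exact isBipartition_splitBy (hA.trans (erase_subset _ _))
  · exact fun hP => hP.exists_eq_splitBy hr

theorem card_bipartitions {S : Finset α} {r : α} (hr : r ∈ S) :
    (bipartitions S r).card = 2 ^ (S.card - 1) := by
  rw [bipartitions, card_image_of_injOn (splitBy_injOn hr), card_powerset, card_erase_of_mem hr]

theorem isSeparating_image_singleton (S : Finset α) (r : α) :
    IsSeparating S ((S.erase r).image fun x => splitBy S {x}) := by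
  have key : ∀ x ∈ S, ∀ y ∈ S, x ≠ y → x ≠ r →
      ∃ P ∈ (S.erase r).image fun x => splitBy S {x}, Cuts P x y := by
    intro x hx y hy hxy hxr
    exact ⟨_, mem_image_of_mem _ (mem_erase.2 ⟨hxr, hx⟩), cuts_splitBy (mem_singleton_self x)
      (mem_sdiff.2 ⟨hy, by simpa using hxy.symm⟩)⟩
  intro x hx y hy hxy
  by_cases hxr : x = r
  · obtain ⟨P, hP, hc⟩ := key y hy x hx hxy.symm (fun h => hxy (hxr.trans h.symm))
    exact ⟨P, hP, hc.symm⟩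
  · exact key x hx y hy hxy hxr

theorem IsSeparating.mono {S : Finset α} {F G : Finset (Finset (Finset α))} (hF : IsSeparating S F)
    (h : F ⊆ G) : IsSeparating S G := by
  intro x hx y hy hxy
  obtain ⟨P, hP, hc⟩ := hF x hx y hy hxy
  exact ⟨P, h hP, hc⟩

/-- A nonempty set `S` has separating families of bipartitions of every size from `|S| - 1` to
`2 ^ (|S| - 1)`. -/
theorem exists_isSeparating_card_eq {S : Finset α} (hS : S.Nonempty) {k : ℕ}
    (hk : S.card - 1 ≤ k) (hk' : k ≤ 2 ^ (S.card - 1)) :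
    ∃ F : Finset (Finset (Finset α)),
      (∀ P ∈ F, IsBipartition S P) ∧ IsSeparating S F ∧ F.card = k := by
  obtain ⟨r, hr⟩ := hS
  have hsub : ((S.erase r).image fun x => splitBy S {x}) ⊆ bipartitions S r := by
    intro P hP
    obtain ⟨x, hx, rfl⟩ := mem_image.1 hP
    exact mem_image_of_mem _ (mem_powerset.2 (singleton_subset_iff.2 hx))
  obtain ⟨F, hF, hF', hcard⟩ := exists_subsuperset_card_eq hsub
    (card_image_le.trans ((card_erase_of_mem hr).trans_le hk))
    (hk'.trans_eq (card_bipartitions hr).symm)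
  exact ⟨F, fun P hP => (mem_bipartitions hr).1 (hF' hP),
    (isSeparating_image_singleton S r).mono hF, hcard⟩

/-- For every `k ≥ 1`, the minimum size of a (nonempty) finite set admitting a
separating family of `k` arbitrary bipartitions is `⌈log₂ k⌉ + 1`. -/
theorem minSize_set_separating (k : ℕ) (hk : 1 ≤ k) :
    (∀ (α : Type) [DecidableEq α] (S : Finset α), S.Nonempty →
      ∀ F : Finset (Finset (Finset α)), (∀ P ∈ F, IsBipartition S P) →
        IsSeparating S F → F.card = k → Nat.clog 2 k + 1 ≤ S.card) ∧
    ∃ F : Finset (Finset (Finset (Fin (Nat.clog 2 k + 1)))),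
      (∀ P ∈ F, IsBipartition Finset.univ P) ∧ IsSeparating Finset.univ F ∧
        F.card = k := by
  constructor
  · intro α _ S ⟨r, hr⟩ F hF _ hcard
    have hle : k ≤ 2 ^ (S.card - 1) := by
      rw [← hcard, ← card_bipartitions hr]
      exact card_le_card fun P hP => (mem_bipartitions hr).2 (hF P hP)
    have hlog := Nat.clog_le_of_le_pow hle
    have hpos : 0 < S.card := card_pos.2 ⟨r, hr⟩
    omega
  · apply exists_isSeparating_card_eq univ_nonempty
    · simpa using Nat.clog_le_of_le_pow Nat.lt_two_pow_self.le
    · simpa using Nat.le_pow_clog one_lt_two k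
end
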